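/- arXiv:1310.2288 — 8 statements merged into one kernel-verified Lean document; each statement's English description precedes it below -/
import Mathlib

section
/- Let f(δ,x) = ⟨x,δ⟩ − log κ(x) for x ∈ 𝔞. For every δ ∈ M, the function x ↦ f(δ,x) attains its maximum over 𝔞 at a unique point s ∈ 𝔞, and this point s is the unique solution of ∇ log κ(s) = δ. -/
open scoped RealInnerProductSpace
open Finset

theorem key_dir {E : Type*} [NormedAddCommGroup E] [InnerProductSpace ℝ E]
    (V : Finset E) (δ : E) (hδ : δ ∈ interior (convexHull ℝ (V : Set E))) :
    ∃ ε > 0, ∀ x : E, ∃ v ∈ V, ε * ‖x‖ ≤ ⟪x, v - δ⟫ := by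
  rw [mem_interior_iff_mem_nhds, Metric.nhds_basis_closedBall.mem_iff] at hδ
  obtain ⟨ε, hε, hball⟩ := hδ
  refine ⟨ε, hε, fun x => ?_⟩
  by_contra! hcon
  have hsub : convexHull ℝ (V : Set E) ⊆ {y | ⟪x, y⟫ < ⟪x, δ⟫ + ε * ‖x‖} := by
    apply convexHull_min
    · intro v hv
      have := hcon v hv
      rw [inner_sub_right] at this
      simp only [Set.mem_ofPred_eq]
      linarith
    · exact convex_halfSpace_lt (innerSL ℝ x).toLinearMap.isLinear _
  have hy : δ + (ε / ‖x‖) • x ∈ Metric.closedBall δ ε := by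
    rw [Metric.mem_closedBall, dist_eq_norm, add_sub_cancel_left, norm_smul, Real.norm_eq_abs,
      abs_of_nonneg (by positivity)]
    by_cases hx : ‖x‖ = 0
    · rw [hx]; simp [hε.le]
    · rw [div_mul_cancel₀ _ hx]
  have h2 := hsub (hball hy)
  simp only [Set.mem_ofPred_eq, inner_add_right, inner_smul_right, real_inner_self_eq_norm_sq] at h2
  by_cases hx : ‖x‖ = 0
  · rw [hx] at h2; simp at h2
  · have : ε / ‖x‖ * ‖x‖ ^ 2 = ε * ‖x‖ := by field_simp
    linarith

theorem kappa_fderiv {E : Type*} [NormedAddCommGroup E] [InnerProductSpace ℝ E]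
    (V : Finset E) (c : E → ℝ) (x : E) :
    HasFDerivAt (fun x => ∑ v ∈ V, c v * Real.exp ⟪x, v⟫)
      (innerSL ℝ (∑ v ∈ V, (c v * Real.exp ⟪x, v⟫) • v)) x := by
  rw [map_sum]
  apply HasFDerivAt.fun_sum
  intro v _
  have h : HasFDerivAt (fun x : E => ⟪x, v⟫) (innerSL ℝ v) x := by
    have := (innerSL ℝ v).hasFDerivAt (x := x)
    refine this.congr_of_eventuallyEq (Filter.Eventually.of_forall fun y => ?_)
    simp [real_inner_comm]
  have := (h.exp).const_mul (c v)
  refine this.congr_fderiv ?_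
  rw [map_smul, smul_smul]

theorem key_strict {E : Type*} [NormedAddCommGroup E] [InnerProductSpace ℝ E]
    (V : Finset E) (c : E → ℝ) (hc : ∀ v ∈ V, 0 < c v) (δ s x : E)
    (hs : ∑ v ∈ V, (c v * Real.exp ⟪s, v⟫) • v = (∑ v ∈ V, c v * Real.exp ⟪s, v⟫) • δ)
    (hx : ∃ v ∈ V, 0 < ⟪x - s, v - δ⟫) :
    ∑ v ∈ V, c v * Real.exp ⟪s, v⟫ <
      (∑ v ∈ V, c v * Real.exp ⟪x, v⟫) * Real.exp (-⟪x - s, δ⟫) := by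
  have h0 : ∑ v ∈ V, (c v * Real.exp ⟪s, v⟫) * ⟪x - s, v - δ⟫ = 0 := by
    have := congrArg (fun y => ⟪x - s, y⟫) hs
    simp only [inner_sum, inner_smul_right] at this
    simp only [inner_sub_right _ _ δ, mul_sub, Finset.sum_sub_distrib, ← Finset.sum_mul, this]
    simp
  have h1 : ∑ v ∈ V, c v * Real.exp ⟪s, v⟫ =
      ∑ v ∈ V, (c v * Real.exp ⟪s, v⟫) * (⟪x - s, v - δ⟫ + 1) := by
    simp only [mul_add, Finset.sum_add_distrib, h0, mul_one, zero_add]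
  have h2 : (∑ v ∈ V, c v * Real.exp ⟪x, v⟫) * Real.exp (-⟪x - s, δ⟫) =
      ∑ v ∈ V, (c v * Real.exp ⟪s, v⟫) * Real.exp ⟪x - s, v - δ⟫ := by
    rw [Finset.sum_mul]
    refine Finset.sum_congr rfl fun v _ => ?_
    rw [mul_assoc, mul_assoc, ← Real.exp_add, ← Real.exp_add]
    congr 2
    simp only [inner_sub_left, inner_sub_right]
    ring
  rw [h1, h2]
  obtain ⟨v, hv, hpos⟩ := hx
  apply Finset.sum_lt_sum
  · intro w hw
    have := hc w hw
    exact mul_le_mul_of_nonneg_left (Real.add_one_le_exp _) (by positivity)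
  · refine ⟨v, hv, ?_⟩
    have := hc v hv
    exact mul_lt_mul_of_pos_left (Real.add_one_lt_exp hpos.ne') (by positivity)

/-- Let `κ x = ∑ v ∈ V, c v * exp ⟪x, v⟫` where `V` is a finite spanning set
of the `r`-dimensional real inner product space `E`, the `c v` are positive and sum to `1`,
and let `M` be the interior of the convex hull of `V`.  For every `δ ∈ M` the function
`x ↦ f δ x = ⟪x, δ⟫ - log (κ x)` attains its maximum over `E` at a unique point `s`, and this
point is the unique solution of `∇ log κ (s) = δ`. -/
theorem statement0 {E : Type*} [NormedAddCommGroup E] [InnerProductSpace ℝ E]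
    [FiniteDimensional ℝ E]
    (V : Finset E) (hspan : Submodule.span ℝ (V : Set E) = ⊤)
    (c : E → ℝ) (hc : ∀ v ∈ V, 0 < c v) (hcsum : ∑ v ∈ V, c v = 1)
    (κ : E → ℝ) (hκ : ∀ x, κ x = ∑ v ∈ V, c v * Real.exp ⟪x, v⟫)
    (M : Set E) (hM : M = interior (convexHull ℝ (V : Set E)))
    (f : E → E → ℝ) (hf : ∀ δ x, f δ x = ⟪x, δ⟫ - Real.log (κ x)) :
    ∀ δ ∈ M, ∃ s : E,
      (∀ x : E, f δ x ≤ f δ s) ∧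
      (∀ s' : E, (∀ x : E, f δ x ≤ f δ s') → s' = s) ∧
      gradient (fun x => Real.log (κ x)) s = δ ∧
      (∀ s' : E, gradient (fun x => Real.log (κ x)) s' = δ → s' = s) := by
  intro δ hδ
  rw [hM] at hδ
  obtain ⟨ε, hε, hdir⟩ := key_dir V δ hδ
  have hκ' : κ = fun x => ∑ v ∈ V, c v * Real.exp ⟪x, v⟫ := funext hκ
  have hne : V.Nonempty := by
    obtain ⟨v, hv, -⟩ := hdir 0
    exact ⟨v, hv⟩
  have hpos : ∀ x, 0 < κ x := fun x => by
    rw [hκ]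
    exact Finset.sum_pos (fun v hv => mul_pos (hc v hv) (Real.exp_pos _)) hne
  have hfd : ∀ x, HasFDerivAt κ (innerSL ℝ (∑ v ∈ V, (c v * Real.exp ⟪x, v⟫) • v)) x := by
    intro x
    rw [hκ']
    exact kappa_fderiv V c x
  have hgrad : ∀ x, HasGradientAt (fun x => Real.log (κ x))
      ((κ x)⁻¹ • ∑ v ∈ V, (c v * Real.exp ⟪x, v⟫) • v) x := by
    intro x
    rw [hasGradientAt_iff_hasFDerivAt]
    have := (hfd x).log (hpos x).ne'
    refine this.congr_fderiv ?_
    ext y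
    simp
  -- critical points are strict maxima
  have hcrit : ∀ s, gradient (fun x => Real.log (κ x)) s = δ → ∀ x, x ≠ s → f δ x < f δ s := by
    intro s hs x hxs
    rw [(hgrad s).gradient, inv_smul_eq_iff₀ (hpos s).ne', hκ s] at hs
    have hx : ∃ v ∈ V, 0 < ⟪x - s, v - δ⟫ := by
      obtain ⟨v, hv, h⟩ := hdir (x - s)
      have : 0 < ‖x - s‖ := norm_pos_iff.2 (sub_ne_zero.2 hxs)
      exact ⟨v, hv, lt_of_lt_of_le (by positivity) h⟩
    have h := key_strict V c hc δ s x hs hx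
    rw [← hκ, ← hκ] at h
    have h' := Real.log_lt_log (hpos s) h
    rw [Real.log_mul (hpos x).ne' (Real.exp_pos _).ne', Real.log_exp, inner_sub_left] at h'
    rw [hf, hf]
    linarith
  -- maxima are critical points
  have hmax : ∀ s, (∀ x, f δ x ≤ f δ s) → gradient (fun x => Real.log (κ x)) s = δ := by
    intro s hs
    have hl : IsLocalMax (f δ) s := Filter.Eventually.of_forall hs
    have hd : HasFDerivAt (f δ) (innerSL ℝ δ -
        InnerProductSpace.toDual ℝ E (gradient (fun x => Real.log (κ x)) s)) s := by
      have h1 := (innerSL ℝ δ).hasFDerivAt (x := s)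
      have h2 := (hgrad s).hasFDerivAt
      rw [← (hgrad s).gradient] at h2
      refine (h1.sub h2).congr_of_eventuallyEq (Filter.Eventually.of_forall fun y => ?_)
      simp [hf, real_inner_comm]
    have h0 := hl.hasFDerivAt_eq_zero hd
    generalize gradient (fun x => Real.log (κ x)) s = g at h0
    refine ext_inner_right ℝ fun y => ?_
    have := congrArg (fun L => L y) h0
    simp at this
    linarith
  -- existence
  have hex : ∃ s, ∀ x, f δ x ≤ f δ s := by
    have hcont : Continuous (fun x => - f δ x) := by
      have hk : Continuous κ := continuous_iff_continuousAt.2 fun x => (hfd x).continuousAt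
      have : (fun x => - f δ x) = fun x => Real.log (κ x) - ⟪x, δ⟫ := by
        funext x; rw [hf]; ring
      rw [this]
      exact (hk.log fun x => (hpos x).ne').sub (continuous_id.inner continuous_const)
    have hlow : ∀ x, - (∑ v ∈ V, |Real.log (c v)|) + ε * ‖x‖ ≤ - f δ x := by
      intro x
      obtain ⟨v, hv, h⟩ := hdir x
      have h1 : c v * Real.exp ⟪x, v⟫ ≤ κ x := by
        rw [hκ]
        exact Finset.single_le_sum (f := fun v => c v * Real.exp ⟪x, v⟫)
          (fun w hw => (mul_pos (hc w hw) (Real.exp_pos _)).le) hv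
      have h2 := Real.log_le_log (mul_pos (hc v hv) (Real.exp_pos _)) h1
      rw [Real.log_mul (hc v hv).ne' (Real.exp_pos _).ne', Real.log_exp] at h2
      have h3 : |Real.log (c v)| ≤ ∑ v ∈ V, |Real.log (c v)| :=
        Finset.single_le_sum (f := fun v => |Real.log (c v)|) (fun w _ => abs_nonneg _) hv
      have h4 := neg_abs_le (Real.log (c v))
      rw [inner_sub_right] at h
      rw [hf]
      linarith
    have ht : Filter.Tendsto (fun x => - f δ x) (Filter.cocompact E) Filter.atTop :=
      Filter.tendsto_atTop_mono hlow (Filter.tendsto_atTop_add_const_left _ _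
        ((tendsto_norm_cocompact_atTop (E := E)).const_mul_atTop hε))
    obtain ⟨s, hs⟩ := hcont.exists_forall_le ht
    exact ⟨s, fun x => neg_le_neg_iff.1 (hs x)⟩
  obtain ⟨s, hs⟩ := hex
  have huniq : ∀ s', gradient (fun x => Real.log (κ x)) s' = δ → s' = s := by
    intro s' h
    by_contra hne
    exact absurd (hcrit s' h s (Ne.symm hne)) (not_lt.2 (hs s'))
  exact ⟨s, hs, fun s' h => huniq s' (hmax s' h), hmax s hs, huniq⟩
end

section
/- Assume Σ_{v∈V} c_v v = 0. Then there exist constants η > 0 and ξ > 0 such that log κ(x) ≥ η‖x‖ for all x ∈ 𝔞 with ‖x‖ ≥ ξ. -/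
open scoped RealInnerProductSpace
open Finset

/-- With `κ x = ∑ v ∈ V, c v * exp ⟪x, v⟫` as above, assuming
`∑ v ∈ V, c v • v = 0`, there exist constants `η > 0` and `ξ > 0` such that
`log (κ x) ≥ η * ‖x‖` for all `x` with `‖x‖ ≥ ξ`. -/
theorem statement1 {E : Type*} [NormedAddCommGroup E] [InnerProductSpace ℝ E]
    [FiniteDimensional ℝ E]
    (V : Finset E) (hspan : Submodule.span ℝ (V : Set E) = ⊤)
    (c : E → ℝ) (hc : ∀ v ∈ V, 0 < c v) (hcsum : ∑ v ∈ V, c v = 1)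
    (κ : E → ℝ) (hκ : ∀ x, κ x = ∑ v ∈ V, c v * Real.exp ⟪x, v⟫)
    (hcent : ∑ v ∈ V, c v • v = 0) :
    ∃ η > (0 : ℝ), ∃ ξ > (0 : ℝ), ∀ x : E, ξ ≤ ‖x‖ → η * ‖x‖ ≤ Real.log (κ x) := by
  have hne : V.Nonempty := by
    rw [Finset.nonempty_iff_ne_empty]
    rintro rfl
    simp at hcsum
  have hpos : ∀ x : E, x ≠ 0 → ∃ v ∈ V, 0 < ⟪x, v⟫ := by
    intro x hx
    by_contra! hcon
    have h1 : ∑ v ∈ V, c v * ⟪x, v⟫ = 0 := by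
      have := congrArg (fun y => ⟪x, y⟫) hcent
      simpa [inner_sum, inner_smul_right] using this
    have h2 := (Finset.sum_eq_zero_iff_of_nonpos (fun v hv =>
      mul_nonpos_of_nonneg_of_nonpos (hc v hv).le (hcon v hv))).1 h1
    have h3 : ∀ v ∈ V, ⟪x, v⟫ = 0 := fun v hv =>
      (mul_eq_zero.1 (h2 v hv)).resolve_left (hc v hv).ne'
    have h4 : x ∈ Submodule.span ℝ (V : Set E) := by rw [hspan]; trivial
    have h5 : ∀ y ∈ Submodule.span ℝ (V : Set E), ⟪x, y⟫ = 0 := by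
      intro y hy
      induction hy using Submodule.span_induction with
      | mem v hv => exact h3 v hv
      | zero => simp
      | add a b _ _ ha hb => rw [inner_add_right, ha, hb, add_zero]
      | smul r a _ ha => rw [inner_smul_right, ha, mul_zero]
    exact hx (inner_self_eq_zero.1 (h5 x h4))
  obtain ⟨m, hm, hmx⟩ : ∃ m > (0 : ℝ), ∀ x : E, ‖x‖ = 1 → ∃ v ∈ V, m ≤ ⟪x, v⟫ := by
    rcases (Metric.sphere (0 : E) 1).eq_empty_or_nonempty with h | h
    · refine ⟨1, one_pos, fun x hx => ?_⟩
      have : x ∈ Metric.sphere (0 : E) 1 := by simpa using hx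
      simp [h] at this
    · have hcont : Continuous (fun x : E => V.sup' hne (fun v => ⟪x, v⟫)) :=
        Continuous.finset_sup'_apply hne (fun v _ => by fun_prop)
      obtain ⟨x₀, hx₀, hmin⟩ := (isCompact_sphere (0 : E) 1).exists_isMinOn h hcont.continuousOn
      refine ⟨V.sup' hne (fun v => ⟪x₀, v⟫), ?_, fun x hx => ?_⟩
      · obtain ⟨v, hv, hv'⟩ := hpos x₀ (by rintro rfl; simp at hx₀)
        exact (Finset.lt_sup'_iff hne).2 ⟨v, hv, hv'⟩
      · have h6 := hmin (show x ∈ Metric.sphere (0 : E) 1 by simpa using hx)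
        exact (Finset.le_sup'_iff hne).1 h6
  obtain ⟨w, hw, hwmin⟩ := V.exists_min_image c hne
  refine ⟨m / 2, by positivity, 2 * |Real.log (c w)| / m + 1, by positivity, fun x hx => ?_⟩
  have hx0 : 0 < ‖x‖ := lt_of_lt_of_le (by positivity) hx
  obtain ⟨v, hv, hvm⟩ := hmx (‖x‖⁻¹ • x) (by
    rw [norm_smul, norm_inv, norm_norm, inv_mul_cancel₀ hx0.ne'])
  have h7 : m * ‖x‖ ≤ ⟪x, v⟫ := by
    rw [real_inner_smul_left, inv_mul_eq_div, le_div_iff₀ hx0] at hvm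
    exact hvm
  have h8 : c v * Real.exp ⟪x, v⟫ ≤ κ x := by
    rw [hκ]
    exact Finset.single_le_sum (f := fun v => c v * Real.exp ⟪x, v⟫)
      (fun u hu => mul_nonneg (hc u hu).le (Real.exp_pos _).le) hv
  have h9 := Real.log_le_log (mul_pos (hc v hv) (Real.exp_pos _)) h8
  rw [Real.log_mul (hc v hv).ne' (Real.exp_pos _).ne', Real.log_exp] at h9
  have h10 := Real.log_le_log (hc w hw) (hwmin v hv)
  have h11 : 2 * |Real.log (c w)| ≤ ‖x‖ * m := by
    rw [← div_le_iff₀ hm]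
    linarith
  have h12 := neg_abs_le (Real.log (c w))
  linarith
end

section
/- Let δ₀ = ∇ log κ(0) = Σ_{v∈V} c_v v. Then there is a constant C > 0 such that C^{-1} ‖δ − δ₀‖² ≤ φ(δ) ≤ C ‖δ − δ₀‖² for all δ ∈ M. -/
open scoped RealInnerProductSpace
open Finset

lemma aux_lower (a c : ℝ) (hc : 0 < c) (hc1 : c ≤ 1) (hp1 : c * Real.exp a ≤ 1) :
    (c * Real.exp a - c) ^ 2 ≤ 4 * (c * Real.exp a * a - c * Real.exp a + c) := by
  have hy : Real.exp a = Real.exp (a / 2) ^ 2 := by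
    rw [← Real.exp_nat_mul]; congr 1; push_cast; ring
  have hy0 : 0 < Real.exp (a / 2) := Real.exp_pos _
  have h2 : -(a / 2) + 1 ≤ Real.exp (-(a / 2)) := Real.add_one_le_exp _
  have h3 : Real.exp (a / 2) * Real.exp (-(a / 2)) = 1 := by rw [← Real.exp_add]; simp
  rw [hy] at hp1 ⊢
  set y := Real.exp (a / 2) with hyd
  have h4 : y - 1 ≤ y * (a / 2) := by nlinarith
  have h5 : c * y * (y - 1) ≤ c * y * (y * (a / 2)) :=
    mul_le_mul_of_nonneg_left h4 (by positivity)
  have h6 : c * (y - 1) ^ 2 ≤ c * y ^ 2 * a - c * y ^ 2 + c := by nlinarith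
  have h7 : c * (y + 1) ^ 2 ≤ 4 := by nlinarith [mul_nonneg hc.le (sq_nonneg (y - 1))]
  calc (c * y ^ 2 - c) ^ 2 = (c * (y - 1) ^ 2) * (c * (y + 1) ^ 2) := by ring
    _ ≤ (c * (y - 1) ^ 2) * 4 := mul_le_mul_of_nonneg_left h7 (by positivity)
    _ ≤ _ := by linarith

lemma aux_upper (a c q : ℝ) (hc : 0 < c) (hq : 0 ≤ q) :
    q * a ≤ (q - c) ^ 2 / c - c + c * Real.exp a := by
  rcases hq.eq_or_lt with rfl | hq
  · have : (0 - c) ^ 2 / c = c := by field_simp; ring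
    rw [this]
    have := Real.exp_pos a
    nlinarith
  · have h1 := Real.log_le_sub_one_of_pos (div_pos (mul_pos hc (Real.exp_pos a)) hq)
    have h2 := Real.log_le_sub_one_of_pos (div_pos hq hc)
    rw [Real.log_div (by positivity) hq.ne', Real.log_mul hc.ne' (Real.exp_pos a).ne',
      Real.log_exp] at h1
    rw [Real.log_div hq.ne' hc.ne'] at h2
    have h3 : a ≤ c * Real.exp a / q - 1 + (q / c - 1) := by linarith
    calc q * a ≤ q * (c * Real.exp a / q - 1 + (q / c - 1)) :=
          mul_le_mul_of_nonneg_left h3 hq.le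
      _ = _ := by field_simp; ring

lemma aux_grad {E : Type*} [NormedAddCommGroup E] [InnerProductSpace ℝ E]
    [FiniteDimensional ℝ E] (V : Finset E) (c : E → ℝ) (x : E)
    (h : 0 < ∑ v ∈ V, c v * Real.exp ⟪x, v⟫) :
    gradient (fun x => Real.log (∑ v ∈ V, c v * Real.exp ⟪x, v⟫)) x
      = ∑ v ∈ V, (c v * Real.exp ⟪x, v⟫ / ∑ v ∈ V, c v * Real.exp ⟪x, v⟫) • v := by
  apply HasGradientAt.gradient
  rw [hasGradientAt_iff_hasFDerivAt]
  have h1 : HasFDerivAt (fun x : E => ∑ v ∈ V, c v * Real.exp ⟪x, v⟫)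
      (∑ v ∈ V, c v • (Real.exp ⟪x, v⟫ • innerSL ℝ v)) x := by
    apply HasFDerivAt.fun_sum
    intro v _
    apply HasFDerivAt.const_mul
    apply HasFDerivAt.exp
    have := (innerSL ℝ v).hasFDerivAt (x := x)
    refine this.congr_of_eventuallyEq (Filter.Eventually.of_forall fun y => ?_)
    simp [real_inner_comm]
  refine (h1.log h.ne').congr_fderiv ?_
  ext y
  simp only [map_sum, map_smul, smul_apply, _root_.sum_apply,
    InnerProductSpace.toDual_apply_apply, innerSL_apply_apply, smul_eq_mul, Finset.mul_sum]
  refine Finset.sum_congr rfl fun v _ => ?_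
  ring


/-- Let `δ₀ = ∇ log κ (0) = ∑ v ∈ V, c v • v`.  Then there is a constant
`C > 0` such that `C⁻¹ ‖δ - δ₀‖² ≤ φ δ ≤ C ‖δ - δ₀‖²` for all `δ ∈ M`, where
`φ δ = ⟪s δ, δ⟫ - log (κ (s δ))` and `s δ` is the unique point with `∇ log κ (s δ) = δ`. -/
theorem statement4 {E : Type*} [NormedAddCommGroup E] [InnerProductSpace ℝ E]
    [FiniteDimensional ℝ E]
    (V : Finset E) (hspan : Submodule.span ℝ (V : Set E) = ⊤)
    (c : E → ℝ) (hc : ∀ v ∈ V, 0 < c v) (hcsum : ∑ v ∈ V, c v = 1)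
    (κ : E → ℝ) (hκ : ∀ x, κ x = ∑ v ∈ V, c v * Real.exp ⟪x, v⟫)
    (M : Set E) (hM : M = interior (convexHull ℝ (V : Set E)))
    (s : E → E) (hs : ∀ δ ∈ M, gradient (fun x => Real.log (κ x)) (s δ) = δ)
    (φ : E → ℝ) (hφ : ∀ δ, φ δ = ⟪s δ, δ⟫ - Real.log (κ (s δ)))
    (δ₀ : E) (hδ₀ : δ₀ = ∑ v ∈ V, c v • v) :
    ∃ C > (0 : ℝ), ∀ δ ∈ M,
      C⁻¹ * ‖δ - δ₀‖ ^ 2 ≤ φ δ ∧ φ δ ≤ C * ‖δ - δ₀‖ ^ 2 := by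
  have hM' : ∀ δ ∈ M, ∃ a : E → ℝ, (∑ v ∈ V, c v * Real.exp (a v) = 1) ∧
      (∑ v ∈ V, (c v * Real.exp (a v)) • v = δ) ∧
      (∀ q : E → ℝ, ∑ v ∈ V, q v = 1 → ∑ v ∈ V, q v • v = δ →
        φ δ = ∑ v ∈ V, q v * a v) := by
    intro δ hδ
    have hVne : V.Nonempty := by
      rw [Finset.nonempty_iff_ne_empty]; rintro rfl; simp at hcsum
    have hpos : 0 < ∑ v ∈ V, c v * Real.exp ⟪s δ, v⟫ :=
      Finset.sum_pos (fun v hv => mul_pos (hc v hv) (Real.exp_pos _)) hVne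
    have hg := hs δ hδ
    rw [funext hκ, aux_grad V c _ hpos] at hg
    have hexp : ∀ v, c v * Real.exp (⟪s δ, v⟫ - Real.log (κ (s δ)))
        = c v * Real.exp ⟪s δ, v⟫ / ∑ v ∈ V, c v * Real.exp ⟪s δ, v⟫ := by
      intro v
      rw [Real.exp_sub, Real.exp_log (by rw [hκ]; exact hpos), hκ, mul_div_assoc]
    refine ⟨fun v => ⟪s δ, v⟫ - Real.log (κ (s δ)), ?_, ?_, ?_⟩
    · simp only [hexp]
      rw [← Finset.sum_div, div_self hpos.ne']
    · simp only [hexp]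
      exact hg
    · intro q hq1 hq2
      rw [hφ]
      have hin : ⟪s δ, δ⟫ = ∑ v ∈ V, q v * ⟪s δ, v⟫ := by
        conv_lhs => rw [← hq2, inner_sum]
        simp only [inner_smul_right, hq2]
      simp only [mul_sub, Finset.sum_sub_distrib]
      rw [← Finset.sum_mul, hq1, one_mul, hin]
  rcases M.eq_empty_or_nonempty with hMe | ⟨m, hm⟩
  · exact ⟨1, one_pos, by simp [hMe]⟩
  have hle1 : ∀ w : E → ℝ, (∀ v ∈ V, 0 ≤ w v) → ∑ v ∈ V, w v = 1 → ∀ v ∈ V, w v ≤ 1 :=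
    fun w h0 h1 v hv => h1 ▸ Finset.single_le_sum h0 hv
  have hc0 : ∀ v ∈ V, 0 ≤ c v := fun v hv => (hc v hv).le
  have hc1 := hle1 c hc0 hcsum
  set K := ∑ v ∈ V, (c v)⁻¹ with hK
  have hcK : ∀ v ∈ V, (c v)⁻¹ ≤ K := fun v hv =>
    Finset.single_le_sum (f := fun v => (c v)⁻¹) (fun v hv => inv_nonneg.2 (hc0 v hv)) hv
  have hK1 : 1 ≤ K := by
    have hVne : V.Nonempty := by
      rw [Finset.nonempty_iff_ne_empty]; rintro rfl; simp at hcsum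
    obtain ⟨v, hv⟩ := hVne
    exact ((one_le_inv₀ (hc v hv)).2 (hc1 v hv)).trans (hcK v hv)
  set S := ∑ v ∈ V, ‖v‖ ^ 2 with hS
  have hS0 : 0 ≤ S := Finset.sum_nonneg fun v _ => sq_nonneg _
  obtain ⟨r, hr, hball⟩ : ∃ r > 0, Metric.closedBall m r ⊆ convexHull ℝ (V : Set E) := by
    rw [hM, mem_interior_iff_mem_nhds] at hm
    exact Metric.nhds_basis_closedBall.mem_iff.1 hm
  have hchi : ∀ δ ∈ M, ∀ q : E → ℝ, (∀ v ∈ V, 0 ≤ q v) → ∑ v ∈ V, q v = 1 →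
      ∑ v ∈ V, q v • v = δ → φ δ ≤ ∑ v ∈ V, (q v - c v) ^ 2 * (c v)⁻¹ := by
    intro δ hδ q hq0 hq1 hq2
    obtain ⟨a, ha1, -, ha3⟩ := hM' δ hδ
    rw [ha3 q hq1 hq2]
    calc ∑ v ∈ V, q v * a v
        ≤ ∑ v ∈ V, ((q v - c v) ^ 2 * (c v)⁻¹ - c v + c v * Real.exp (a v)) :=
          Finset.sum_le_sum fun v hv => aux_upper _ _ _ (hc v hv) (hq0 v hv)
      _ = _ := by rw [Finset.sum_add_distrib, Finset.sum_sub_distrib, hcsum, ha1]; ring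
  have hsq : ∀ w w' : E → ℝ, (∀ v ∈ V, 0 ≤ w v) → (∀ v ∈ V, 0 ≤ w' v) →
      ∑ v ∈ V, w v = 1 → ∑ v ∈ V, w' v = 1 →
      ∑ v ∈ V, (w v - w' v) ^ 2 * (c v)⁻¹ ≤ K := by
    intro w w' h0 h0' h1 h1'
    refine Finset.sum_le_sum fun v hv => ?_
    have e1 := hle1 w h0 h1 v hv
    have e2 := hle1 w' h0' h1' v hv
    have e3 := h0 v hv
    have e4 := h0' v hv
    have : (w v - w' v) ^ 2 ≤ 1 := by
      rw [sq_le_one_iff_abs_le_one, abs_le]; constructor <;> linarith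
    exact mul_le_of_le_one_left (inv_nonneg.2 (hc0 v hv)) this
  have hB : 0 ≤ K ^ 3 / r ^ 2 := by positivity
  refine ⟨4 * S + K ^ 3 / r ^ 2 + 1, by positivity, fun δ hδ => ?_⟩
  obtain ⟨a, ha1, ha2, ha3⟩ := hM' δ hδ
  have hp0 : ∀ v ∈ V, 0 ≤ c v * Real.exp (a v) := fun v hv =>
    mul_nonneg (hc0 v hv) (Real.exp_pos _).le
  constructor
  · have hφ1 : ∑ v ∈ V, (c v * Real.exp (a v) - c v) ^ 2 ≤ 4 * φ δ := by
      rw [ha3 _ ha1 ha2]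
      calc _ ≤ ∑ v ∈ V, 4 * (c v * Real.exp (a v) * a v - c v * Real.exp (a v) + c v) :=
            Finset.sum_le_sum fun v hv =>
              aux_lower _ _ (hc v hv) (hc1 v hv) (hle1 _ hp0 ha1 v hv)
        _ = _ := by
            rw [← Finset.mul_sum, Finset.sum_add_distrib, Finset.sum_sub_distrib, hcsum, ha1]
            ring
    have hφ0 : 0 ≤ φ δ := by
      have : 0 ≤ ∑ v ∈ V, (c v * Real.exp (a v) - c v) ^ 2 :=
        Finset.sum_nonneg fun v _ => sq_nonneg _
      linarith
    have hn : ‖δ - δ₀‖ ^ 2 ≤ (∑ v ∈ V, (c v * Real.exp (a v) - c v) ^ 2) * S := by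
      have e : δ - δ₀ = ∑ v ∈ V, (c v * Real.exp (a v) - c v) • v := by
        simp only [sub_smul, Finset.sum_sub_distrib, ha2, hδ₀]
      calc ‖δ - δ₀‖ ^ 2 ≤ (∑ v ∈ V, |c v * Real.exp (a v) - c v| * ‖v‖) ^ 2 := by
            rw [e]
            gcongr
            refine (norm_sum_le _ _).trans_eq (Finset.sum_congr rfl fun v _ => ?_)
            rw [norm_smul, Real.norm_eq_abs]
        _ ≤ (∑ v ∈ V, |c v * Real.exp (a v) - c v| ^ 2) * ∑ v ∈ V, ‖v‖ ^ 2 :=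
            Finset.sum_mul_sq_le_sq_mul_sq _ _ _
        _ = _ := by simp only [sq_abs, hS]
    rw [inv_mul_le_iff₀ (by positivity)]
    nlinarith [mul_le_mul_of_nonneg_right hφ1 hS0, mul_nonneg hB hφ0]
  · set t := ‖δ - δ₀‖ / r with ht
    have ht0 : 0 ≤ t := by positivity
    have hmain : φ δ ≤ K ^ 3 * t ^ 2 := by
      rcases le_or_gt (t * K) 1 with htK | htK
      · set m' := m + (r / ‖δ - δ₀‖) • (δ - δ₀) with hm'
        have hm'mem : m' ∈ convexHull ℝ (V : Set E) := by
          apply hball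
          rw [Metric.mem_closedBall, dist_eq_norm, hm', add_sub_cancel_left, norm_smul,
            Real.norm_eq_abs, abs_of_nonneg (by positivity)]
          rcases eq_or_ne ‖δ - δ₀‖ 0 with h0 | h0
          · rw [h0, mul_zero]; exact hr.le
          · rw [div_mul_cancel₀ _ h0]
        have hmmem : m ∈ convexHull ℝ (V : Set E) := hball (Metric.mem_closedBall_self hr.le)
        obtain ⟨w, hw0, hw1, hw2⟩ := Finset.mem_convexHull'.1 hmmem
        obtain ⟨w', hw0', hw1', hw2'⟩ := Finset.mem_convexHull'.1 hm'mem
        have htm : t • (m' - m) = δ - δ₀ := by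
          rw [hm', add_sub_cancel_left, smul_smul]
          rcases eq_or_ne (δ - δ₀) 0 with h0 | h0
          · rw [h0, smul_zero]
          · have : ‖δ - δ₀‖ ≠ 0 := norm_ne_zero_iff.2 h0
            rw [ht, show ‖δ - δ₀‖ / r * (r / ‖δ - δ₀‖) = 1 by field_simp, one_smul]
        have h1 := hchi δ hδ (fun v => c v + t * (w' v - w v)) ?_ ?_ ?_
        · have h2 := hsq w' w hw0' hw0 hw1' hw1
          calc φ δ ≤ _ := h1
            _ = t ^ 2 * ∑ v ∈ V, (w' v - w v) ^ 2 * (c v)⁻¹ := by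
              rw [Finset.mul_sum]; refine Finset.sum_congr rfl fun v _ => ?_
              ring
            _ ≤ t ^ 2 * K := by gcongr
            _ ≤ t ^ 2 * K ^ 3 := by
              gcongr
              exact le_self_pow₀ hK1 (by norm_num)
            _ = _ := by ring
        · intro v hv
          have e1 := hw0' v hv
          have e2 := hle1 w hw0 hw1 v hv
          have e3 : t ≤ c v := by
            have := mul_le_mul_of_nonneg_left (hcK v hv) ht0
            have h5 : t * (c v)⁻¹ ≤ 1 := this.trans htK
            rwa [← div_eq_mul_inv, div_le_one (hc v hv)] at h5
          show 0 ≤ c v + t * (w' v - w v)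
          nlinarith [mul_nonneg ht0 e1, mul_nonneg ht0 (sub_nonneg.2 e2)]
        · rw [Finset.sum_add_distrib, ← Finset.mul_sum, Finset.sum_sub_distrib, hcsum, hw1, hw1']
          ring
        · simp only [add_smul, mul_smul, sub_smul, Finset.sum_add_distrib, ← Finset.smul_sum,
            Finset.sum_sub_distrib, hw2, hw2', htm, ← hδ₀]
          abel
      · have h1 := hchi δ hδ _ hp0 ha1 ha2
        have h2 := hsq _ c hp0 hc0 ha1 hcsum
        have h3 : 1 ≤ (t * K) ^ 2 := one_le_pow₀ htK.le
        nlinarith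
    have e : K ^ 3 * t ^ 2 = K ^ 3 / r ^ 2 * ‖δ - δ₀‖ ^ 2 := by rw [ht]; ring
    rw [e] at hmain
    nlinarith [mul_nonneg hS0 (sq_nonneg ‖δ - δ₀‖), sq_nonneg ‖δ - δ₀‖]
end

section
/- Define φ(x,θ) = −∫₀¹ (1−t) D_θ² log κ(x + i t θ) dt for x, θ ∈ 𝔞 with ‖θ‖ < (4 max{‖v‖ : v ∈ V})^{-1}, where D_θ² log κ(x+itθ) is the second directional derivative of log κ at x+itθ in the direction θ. Then 4 Re φ(x,θ) ≤ − B_x(θ,θ) for all such x and θ. -/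
open scoped RealInnerProductSpace
open Finset

/-- Lower bound for the real part of a product of four unimodular numbers. -/
lemma aux_cos (α β : ℝ) (h : |α - β| ≤ 1) :
    1 / 2 ≤ (Complex.exp ((α : ℂ) * Complex.I) *
      (starRingEnd ℂ) (Complex.exp ((β : ℂ) * Complex.I))).re := by
  have : Complex.exp ((α : ℂ) * Complex.I) *
      (starRingEnd ℂ) (Complex.exp ((β : ℂ) * Complex.I)) =
      Complex.exp (((α - β : ℝ) : ℂ) * Complex.I) := by
    rw [← Complex.exp_conj, ← Complex.exp_add]
    congr 1
    simp
    ring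
  rw [this, Complex.exp_ofReal_mul_I_re]
  have h1 := Real.one_sub_sq_div_two_le_cos (x := α - β)
  have h2 : (α - β) ^ 2 ≤ 1 := by
    rw [← sq_abs]; nlinarith [abs_nonneg (α - β)]
  linarith

/-- Real part of the sum. -/
lemma aux_ne {ι : Type*} (s : Finset ι) (hs : s.Nonempty) (p b : ι → ℝ)
    (hp : ∀ v ∈ s, 0 < p v) (hb : ∀ v ∈ s, |b v| ≤ 1) :
    0 < (∑ v ∈ s, (p v : ℂ) * Complex.exp ((b v : ℂ) * Complex.I)).re := by
  rw [Complex.re_sum]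
  refine Finset.sum_pos (fun v hv => ?_) hs
  rw [Complex.re_ofReal_mul]
  have := aux_cos (b v) 0 (by simpa using hb v hv)
  simp only [Complex.ofReal_zero, zero_mul, Complex.exp_zero, map_one, mul_one] at this
  exact mul_pos (hp v hv) (by linarith)

/-- The key pointwise inequality. -/
lemma aux_key {ι : Type*} (s : Finset ι) (hs : s.Nonempty) (p a : ι → ℝ) (t : ℝ)
    (hp : ∀ v ∈ s, 0 < p v) (ht0 : 0 ≤ t) (ht1 : t ≤ 1) (ha : ∀ v ∈ s, |a v| ≤ 1 / 4)
    (e : ι → ℂ) (he : ∀ v, e v = Complex.exp (((t * a v : ℝ) : ℂ) * Complex.I)) :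
    (1 / 2) * (((∑ v ∈ s, p v * a v * a v) * (∑ v ∈ s, p v)
        - (∑ v ∈ s, p v * a v) * (∑ v ∈ s, p v * a v)) / (∑ v ∈ s, p v) ^ 2) ≤
      (((∑ v ∈ s, ((p v * a v * a v : ℝ) : ℂ) * e v) * (∑ v ∈ s, (p v : ℂ) * e v)
        - (∑ v ∈ s, ((p v * a v : ℝ) : ℂ) * e v) * (∑ v ∈ s, ((p v * a v : ℝ) : ℂ) * e v))
          / (∑ v ∈ s, (p v : ℂ) * e v) ^ 2).re := by
  set Q := ∑ v ∈ s, p v with hQ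
  set Z := ∑ v ∈ s, (p v : ℂ) * e v with hZ
  have hQpos : 0 < Q := Finset.sum_pos hp hs
  have hta : ∀ v ∈ s, |t * a v| ≤ 1 / 4 := by
    intro v hv
    rw [abs_mul, abs_of_nonneg ht0]
    nlinarith [ha v hv, abs_nonneg (a v)]
  have hZne : Z ≠ 0 := by
    have := aux_ne s hs p (fun v => t * a v) hp (fun v hv => (hta v hv).trans (by norm_num))
    intro h0
    simp only [← he, ← hZ, h0] at this
    simp at this
  have hZle : ‖Z‖ ≤ Q := by
    refine (norm_sum_le _ _).trans (Finset.sum_le_sum fun v hv => ?_)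
    rw [norm_mul, he, Complex.norm_exp_ofReal_mul_I, mul_one, Complex.norm_real,
      Real.norm_of_nonneg (hp v hv).le]
  have hM : (∑ v ∈ s, p v * a v * a v) * Q - (∑ v ∈ s, p v * a v) * (∑ v ∈ s, p v * a v)
      = ∑ v ∈ s, ∑ w ∈ s, p v * p w * (a v - a w) ^ 2 / 2 := by
    have h1 : (∑ v ∈ s, p v * a v * a v) * Q = ∑ v ∈ s, ∑ w ∈ s, p v * a v * a v * p w :=
      Finset.sum_mul_sum _ _ _ _
    have h2 : Q * (∑ v ∈ s, p v * a v * a v) = ∑ v ∈ s, ∑ w ∈ s, p v * (p w * a w * a w) :=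
      Finset.sum_mul_sum _ _ _ _
    have h3 := Finset.sum_mul_sum s s (fun v => p v * a v) (fun v => p v * a v)
    have h4 : (∑ v ∈ s, p v * a v * a v) * Q = ((∑ v ∈ s, p v * a v * a v) * Q
       + Q * (∑ v ∈ s, p v * a v * a v)) / 2 := by ring
    rw [h4, h1, h2, h3]
    simp only [← Finset.sum_add_distrib, ← Finset.sum_sub_distrib, Finset.sum_div]
    refine Finset.sum_congr rfl fun v _ => Finset.sum_congr rfl fun w _ => ?_
    ring
  have hN : (∑ v ∈ s, ((p v * a v * a v : ℝ) : ℂ) * e v) * Z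
        - (∑ v ∈ s, ((p v * a v : ℝ) : ℂ) * e v) * (∑ v ∈ s, ((p v * a v : ℝ) : ℂ) * e v)
      = ∑ v ∈ s, ∑ w ∈ s, ((p v * p w * (a v - a w) ^ 2 / 2 : ℝ) : ℂ) * (e v * e w) := by
    set P2 := ∑ v ∈ s, ((p v * a v * a v : ℝ) : ℂ) * e v with hP2
    have h1 : P2 * Z = ∑ v ∈ s, ∑ w ∈ s, (((p v * a v * a v : ℝ) : ℂ) * e v) * ((p w : ℂ) * e w) :=
      Finset.sum_mul_sum _ _ _ _
    have h2 : Z * P2 = ∑ v ∈ s, ∑ w ∈ s, ((p v : ℂ) * e v) * (((p w * a w * a w : ℝ) : ℂ) * e w) :=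
      Finset.sum_mul_sum _ _ _ _
    have h3 := Finset.sum_mul_sum s s (fun v => ((p v * a v : ℝ) : ℂ) * e v)
      (fun v => ((p v * a v : ℝ) : ℂ) * e v)
    have h4 : P2 * Z = (P2 * Z + Z * P2) / 2 := by ring
    rw [h4, h1, h2, h3]
    simp only [← Finset.sum_add_distrib, ← Finset.sum_sub_distrib, Finset.sum_div]
    refine Finset.sum_congr rfl fun v _ => Finset.sum_congr rfl fun w _ => ?_
    push_cast
    ring
  have hterm : ∀ v ∈ s, ∀ w ∈ s,
      1 / 2 * Q ^ 2 ≤ ((e v * e w) * (starRingEnd ℂ) Z ^ 2).re := by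
    intro v hv w hw
    have h1 : (e v * e w) * (starRingEnd ℂ) Z ^ 2 = ∑ u ∈ s, ∑ u' ∈ s,
        ((p u * p u' : ℝ) : ℂ) * ((e v * e w) * (starRingEnd ℂ) (e u * e u')) := by
      rw [hZ, map_sum, pow_two, Finset.sum_mul_sum, Finset.mul_sum]
      refine Finset.sum_congr rfl fun u _ => ?_
      rw [Finset.mul_sum]
      refine Finset.sum_congr rfl fun u' _ => ?_
      simp only [map_mul, Complex.conj_ofReal]
      push_cast
      ring
    have h2 : 1 / 2 * Q ^ 2 = ∑ u ∈ s, ∑ u' ∈ s, p u * p u' * (1 / 2) := by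
      rw [pow_two, hQ, Finset.sum_mul_sum, Finset.mul_sum]
      refine Finset.sum_congr rfl fun u _ => ?_
      rw [Finset.mul_sum]
      refine Finset.sum_congr rfl fun u' _ => ?_
      ring
    rw [h1, h2, Complex.re_sum]
    refine Finset.sum_le_sum fun u hu => ?_
    rw [Complex.re_sum]
    refine Finset.sum_le_sum fun u' hu' => ?_
    rw [Complex.re_ofReal_mul]
    refine mul_le_mul_of_nonneg_left ?_ (mul_pos (hp u hu) (hp u' hu')).le
    have hee : ∀ i j, e i * e j
        = Complex.exp (((t * a i + t * a j : ℝ) : ℂ) * Complex.I) := by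
      intro i j
      rw [he, he, ← Complex.exp_add]
      congr 1
      push_cast
      ring
    rw [hee, hee]
    refine aux_cos _ _ ?_
    have := abs_le.1 (hta v hv)
    have := abs_le.1 (hta w hw)
    have := abs_le.1 (hta u hu)
    have := abs_le.1 (hta u' hu')
    rw [abs_le]
    constructor <;> linarith
  rw [hM, hN]
  set M := ∑ v ∈ s, ∑ w ∈ s, p v * p w * (a v - a w) ^ 2 / 2 with hMdef
  set N := ∑ v ∈ s, ∑ w ∈ s, ((p v * p w * (a v - a w) ^ 2 / 2 : ℝ) : ℂ) * (e v * e w) with hNdef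
  have hM0 : 0 ≤ M := Finset.sum_nonneg fun v hv => Finset.sum_nonneg fun w hw => by
    have := hp v hv
    have := hp w hw
    positivity
  have hNre : M * (1 / 2 * Q ^ 2) ≤ (N * (starRingEnd ℂ) Z ^ 2).re := by
    rw [hNdef, hMdef, Finset.sum_mul, Finset.sum_mul, Complex.re_sum]
    refine Finset.sum_le_sum fun v hv => ?_
    rw [Finset.sum_mul, Finset.sum_mul, Complex.re_sum]
    refine Finset.sum_le_sum fun w hw => ?_
    rw [mul_assoc ((_ : ℝ) : ℂ), Complex.re_ofReal_mul]
    refine mul_le_mul_of_nonneg_left (hterm v hv w hw) ?_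
    have := hp v hv
    have := hp w hw
    positivity
  have hZpos : 0 < ‖Z‖ := norm_pos_iff.2 hZne
  have hdiv : N / Z ^ 2 = ((1 / ‖Z‖ ^ 4 : ℝ) : ℂ) * (N * (starRingEnd ℂ) Z ^ 2) := by
    have h1 : Z * (starRingEnd ℂ) Z = ((‖Z‖ ^ 2 : ℝ) : ℂ) := by
      rw [Complex.mul_conj, Complex.normSq_eq_norm_sq]
    have h2 : ((‖Z‖ ^ 4 : ℝ) : ℂ) = Z ^ 2 * (starRingEnd ℂ) Z ^ 2 := by
      rw [← mul_pow, h1]; push_cast; ring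
    have h3 : (starRingEnd ℂ) Z ≠ 0 := by simpa using hZne
    rw [Complex.ofReal_div, h2]
    field_simp
    simp
  rw [hdiv, Complex.re_ofReal_mul]
  have h4 : ‖Z‖ ^ 4 ≤ Q ^ 4 := by gcongr
  calc 1 / 2 * (M / Q ^ 2) = 1 / Q ^ 4 * (M * (1 / 2 * Q ^ 2)) := by field_simp
    _ ≤ 1 / ‖Z‖ ^ 4 * (M * (1 / 2 * Q ^ 2)) := by gcongr
    _ ≤ _ := by gcongr

/-- Derivative of complex exponential sums. -/
lemma aux_derivC {E : Type*} [NormedAddCommGroup E] [InnerProductSpace ℝ E]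
    (V : Finset E) (d : E → ℂ) (b : E → ℝ) (θ y : E) :
    ∃ L : E →L[ℝ] ℂ, HasFDerivAt (fun y' : E => ∑ v ∈ V,
      d v * Complex.exp ((⟪y', v⟫ : ℝ) + (b v : ℂ) * Complex.I)) L y ∧
      L θ = ∑ v ∈ V, (d v * (⟪θ, v⟫ : ℝ)) *
        Complex.exp ((⟪y, v⟫ : ℝ) + (b v : ℂ) * Complex.I) := by
  have h : ∀ v ∈ V, HasFDerivAt (fun y' : E =>
      d v * Complex.exp ((⟪y', v⟫ : ℝ) + (b v : ℂ) * Complex.I))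
      (d v • (Complex.exp ((⟪y, v⟫ : ℝ) + (b v : ℂ) * Complex.I) •
        (Complex.ofRealCLM.comp (innerSL ℝ v)))) y := by
    intro v _
    have h1 : HasFDerivAt (fun y' : E => ((⟪y', v⟫ : ℝ) : ℂ) + (b v : ℂ) * Complex.I)
        (Complex.ofRealCLM.comp (innerSL ℝ v)) y := by
      refine HasFDerivAt.add_const _ ?_
      have := (Complex.ofRealCLM.comp (innerSL ℝ v)).hasFDerivAt (x := y)
      refine this.congr_of_eventuallyEq (Filter.Eventually.of_forall fun z => ?_)
      simp [real_inner_comm]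
    exact (h1.cexp).const_mul (d v)
  refine ⟨_, HasFDerivAt.fun_sum h, ?_⟩
  rw [_root_.sum_apply]
  refine Finset.sum_congr rfl fun v _ => ?_
  simp [real_inner_comm]
  ring

/-- Derivative of real exponential sums. -/
lemma aux_derivR {E : Type*} [NormedAddCommGroup E] [InnerProductSpace ℝ E]
    (V : Finset E) (d : E → ℝ) (θ y : E) :
    ∃ L : E →L[ℝ] ℝ, HasFDerivAt (fun y' : E => ∑ v ∈ V, d v * Real.exp ⟪y', v⟫) L y ∧
      L θ = ∑ v ∈ V, (d v * ⟪θ, v⟫) * Real.exp ⟪y, v⟫ := by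
  have h : ∀ v ∈ V, HasFDerivAt (fun y' : E => d v * Real.exp ⟪y', v⟫)
      (d v • (Real.exp ⟪y, v⟫ • (innerSL ℝ v))) y := by
    intro v _
    have h1 : HasFDerivAt (fun y' : E => (⟪y', v⟫ : ℝ)) (innerSL ℝ v) y := by
      have := (innerSL ℝ v).hasFDerivAt (x := y)
      refine this.congr_of_eventuallyEq (Filter.Eventually.of_forall fun z => ?_)
      simp [real_inner_comm]
    exact (h1.exp).const_mul (d v)
  refine ⟨_, HasFDerivAt.fun_sum h, ?_⟩
  rw [_root_.sum_apply]
  refine Finset.sum_congr rfl fun v _ => ?_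
  simp [real_inner_comm]
  ring

/-- Quotient rule applied to a direction. -/
lemma aux_div {E 𝕜 : Type*} [NormedAddCommGroup E] [NormedSpace ℝ E]
    [NontriviallyNormedField 𝕜] [NormedAlgebra ℝ 𝕜] (f g : E → 𝕜) (f' g' : E →L[ℝ] 𝕜)
    (x θ : E) (hf : HasFDerivAt f f' x) (hg : HasFDerivAt g g' x) (h0 : g x ≠ 0) :
    fderiv ℝ (fun y => f y / g y) x θ = (f' θ * g x - f x * g' θ) / g x ^ 2 := by
  have h1 := (hasDerivAt_inv h0).hasFDerivAt.restrictScalars ℝ |>.comp x hg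
  have h2 := hf.mul h1
  have h3 : (fun y => f y / g y) = (f * (Inv.inv ∘ g)) := by
    funext y; simp [div_eq_mul_inv]
  rw [h3, h2.fderiv]
  simp
  field_simp
  ring
/-- Define `φ(x,θ) = -∫₀¹ (1-t) D_θ² log κ (x + itθ) dt`, where
`D_θ² log κ (x + itθ)` is the second directional derivative of `log κ` (the complex logarithm
of `κ(z) = ∑ v ∈ V, c v e^{⟨z,v⟩}`, bilinear extension of the inner product) at the point
`x + itθ` in the real direction `θ`.  Then `4 Re φ(x,θ) ≤ -B_x(θ,θ)` for all `x, θ` with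
`‖θ‖ < (4 max ‖v‖)⁻¹`, where `B_x` is the Hessian bilinear form of `log κ` at the real
point `x`. -/
theorem statement9 {E : Type*} [NormedAddCommGroup E] [InnerProductSpace ℝ E]
    [FiniteDimensional ℝ E]
    (V : Finset E) (hVne : V.Nonempty) (hspan : Submodule.span ℝ (V : Set E) = ⊤)
    (c : E → ℝ) (hc : ∀ v ∈ V, 0 < c v) (hcsum : ∑ v ∈ V, c v = 1)
    (κ : E → ℝ) (hκ : ∀ x, κ x = ∑ v ∈ V, c v * Real.exp ⟪x, v⟫)
    (B : E → E → E → ℝ)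
    (hB : ∀ x u u', B x u u' =
      fderiv ℝ (fun y => fderiv ℝ (fun z => Real.log (κ z)) y u') x u)
    (φ : E → E → ℂ)
    (hφ : ∀ x θ, φ x θ =
      -∫ t in (0:ℝ)..1, ((1 - t : ℝ) : ℂ) *
        fderiv ℝ (fun y =>
          fderiv ℝ (fun y' => Complex.log (∑ v ∈ V,
            (c v : ℂ) * Complex.exp ((⟪y', v⟫ : ℝ) + ((t * ⟪θ, v⟫ : ℝ) : ℂ) * Complex.I)))
            y θ) x θ) :
    ∀ x θ : E, ‖θ‖ < (4 * V.sup' hVne (fun v => ‖v‖))⁻¹ →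
      4 * (φ x θ).re ≤ -B x θ θ := by
  intro x θ hθ
  have ha : ∀ v ∈ V, |⟪θ, v⟫| ≤ 1 / 4 := by
    intro v hv
    set m := V.sup' hVne (fun v => ‖v‖) with hm
    have hvm : ‖v‖ ≤ m := Finset.le_sup' (fun v => ‖v‖) hv
    have hm0 : 0 < m := by
      have h1 : 0 < (4 * m)⁻¹ := (norm_nonneg θ).trans_lt hθ
      have := inv_pos.1 h1
      linarith
    have h2 : ‖θ‖ * (4 * m) < 1 := by
      rwa [← lt_div_iff₀ (by positivity), one_div]
    have h3 := abs_real_inner_le_norm θ v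
    nlinarith [norm_nonneg θ]
  set p : E → ℝ := fun v => c v * Real.exp ⟪x, v⟫ with hp
  have hp0 : ∀ v ∈ V, 0 < p v := fun v hv => mul_pos (hc v hv) (Real.exp_pos _)
  set a : E → ℝ := fun v => ⟪θ, v⟫ with hadef
  -- the real Hessian
  have hκpos : ∀ y, 0 < ∑ v ∈ V, c v * Real.exp ⟪y, v⟫ := fun y =>
    Finset.sum_pos (fun v hv => mul_pos (hc v hv) (Real.exp_pos _)) hVne
  have hBval : B x θ θ = ((∑ v ∈ V, p v * a v * a v) * (∑ v ∈ V, p v)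
        - (∑ v ∈ V, p v * a v) * (∑ v ∈ V, p v * a v)) / (∑ v ∈ V, p v) ^ 2 := by
    rw [hB]
    have h1 : (fun y => fderiv ℝ (fun z => Real.log (κ z)) y θ) = fun y =>
        (∑ v ∈ V, (c v * ⟪θ, v⟫) * Real.exp ⟪y, v⟫) / (∑ v ∈ V, c v * Real.exp ⟪y, v⟫) := by
      funext y
      obtain ⟨L, hL, hLθ⟩ := aux_derivR V c θ y
      have h2 : (fun z => Real.log (κ z)) = fun z =>
          Real.log (∑ v ∈ V, c v * Real.exp ⟪z, v⟫) := by
        funext z; rw [hκ]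
      rw [h2, (hL.log (hκpos y).ne').fderiv]
      simp [hLθ]
      field_simp
    obtain ⟨L, hL, hLθ⟩ := aux_derivR V c θ x
    obtain ⟨L1, hL1, hL1θ⟩ := aux_derivR V (fun v => c v * ⟪θ, v⟫) θ x
    rw [h1, aux_div _ _ _ _ _ _ hL1 hL (hκpos x).ne', hLθ, hL1θ]
    have e1 : ∑ v ∈ V, c v * ⟪θ, v⟫ * Real.exp ⟪x, v⟫ = ∑ v ∈ V, p v * a v :=
      Finset.sum_congr rfl fun v _ => by simp only [hp, hadef]; ring
    have e2 : ∑ v ∈ V, c v * ⟪θ, v⟫ * ⟪θ, v⟫ * Real.exp ⟪x, v⟫ = ∑ v ∈ V, p v * a v * a v :=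
      Finset.sum_congr rfl fun v _ => by simp only [hp, hadef]; ring
    rw [e1, e2]
  -- the complex second derivative
  set e : ℝ → E → ℂ := fun t v => Complex.exp (((t * a v : ℝ) : ℂ) * Complex.I) with he
  set F : ℝ → ℂ := fun t =>
      ((∑ v ∈ V, ((p v * a v * a v : ℝ) : ℂ) * e t v) * (∑ v ∈ V, (p v : ℂ) * e t v)
        - (∑ v ∈ V, ((p v * a v : ℝ) : ℂ) * e t v) * (∑ v ∈ V, ((p v * a v : ℝ) : ℂ) * e t v))
          / (∑ v ∈ V, (p v : ℂ) * e t v) ^ 2 with hF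
  have hta : ∀ t ∈ Set.Icc (0:ℝ) 1, ∀ v ∈ V, |t * a v| ≤ 1 := by
    intro t ht v hv
    rw [abs_mul, abs_of_nonneg ht.1]
    have : |a v| ≤ 1 / 4 := ha v hv
    nlinarith [ht.1, ht.2, abs_nonneg (a v)]
  have hexp : ∀ (t : ℝ) (y v : E),
      Complex.exp ((⟪y, v⟫ : ℝ) + ((t * ⟪θ, v⟫ : ℝ) : ℂ) * Complex.I) =
      ((Real.exp ⟪y, v⟫ : ℝ) : ℂ) * e t v := by
    intro t y v
    rw [Complex.exp_add, Complex.ofReal_exp]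
  have hre : ∀ t ∈ Set.Icc (0:ℝ) 1, ∀ y : E, 0 < (∑ v ∈ V,
      (c v : ℂ) * Complex.exp ((⟪y, v⟫ : ℝ) + ((t * ⟪θ, v⟫ : ℝ) : ℂ) * Complex.I)).re := by
    intro t ht y
    have := aux_ne V hVne (fun v => c v * Real.exp ⟪y, v⟫) (fun v => t * a v)
      (fun v hv => mul_pos (hc v hv) (Real.exp_pos _)) (hta t ht)
    convert this using 2
    refine Finset.sum_congr rfl fun v _ => ?_
    rw [hexp, Complex.ofReal_mul, mul_assoc]
  have hne : ∀ t ∈ Set.Icc (0:ℝ) 1, ∀ y : E, (∑ v ∈ V,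
      (c v : ℂ) * Complex.exp ((⟪y, v⟫ : ℝ) + ((t * ⟪θ, v⟫ : ℝ) : ℂ) * Complex.I)) ≠ 0 := by
    intro t ht y h0
    have := hre t ht y
    rw [h0] at this
    simp at this
  have e0 : ∀ t, ∑ v ∈ V, (c v : ℂ) *
      Complex.exp ((⟪x, v⟫ : ℝ) + ((t * ⟪θ, v⟫ : ℝ) : ℂ) * Complex.I)
      = ∑ v ∈ V, (p v : ℂ) * e t v := fun t =>
    Finset.sum_congr rfl fun v _ => by
      rw [hexp]; simp only [hp]; push_cast; ring
  have hD : ∀ t ∈ Set.Icc (0:ℝ) 1, fderiv ℝ (fun y =>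
          fderiv ℝ (fun y' => Complex.log (∑ v ∈ V,
            (c v : ℂ) * Complex.exp ((⟪y', v⟫ : ℝ) + ((t * ⟪θ, v⟫ : ℝ) : ℂ) * Complex.I)))
            y θ) x θ = F t := by
    intro t ht
    have h1 : (fun y => fderiv ℝ (fun y' => Complex.log (∑ v ∈ V,
            (c v : ℂ) * Complex.exp ((⟪y', v⟫ : ℝ) + ((t * ⟪θ, v⟫ : ℝ) : ℂ) * Complex.I)))
            y θ) = fun y => (∑ v ∈ V, ((c v : ℂ) * (⟪θ, v⟫ : ℝ)) *
              Complex.exp ((⟪y, v⟫ : ℝ) + ((t * ⟪θ, v⟫ : ℝ) : ℂ) * Complex.I)) /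
            (∑ v ∈ V, (c v : ℂ) *
              Complex.exp ((⟪y, v⟫ : ℝ) + ((t * ⟪θ, v⟫ : ℝ) : ℂ) * Complex.I)) := by
      funext y
      obtain ⟨L, hL, hLθ⟩ := aux_derivC V (fun v => (c v : ℂ)) (fun v => t * ⟪θ, v⟫) θ y
      have hlog := (Complex.hasStrictDerivAt_log (Or.inl (hre t ht y))).hasDerivAt.hasFDerivAt.restrictScalars
        ℝ |>.comp y hL
      have h2 := hlog.fderiv
      rw [Function.comp_def] at h2
      rw [h2, ← hLθ]
      simp [div_eq_mul_inv]
    obtain ⟨L, hL, hLθ⟩ := aux_derivC V (fun v => (c v : ℂ)) (fun v => t * ⟪θ, v⟫) θ x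
    obtain ⟨L1, hL1, hL1θ⟩ := aux_derivC V (fun v => (c v : ℂ) * (⟪θ, v⟫ : ℝ))
      (fun v => t * ⟪θ, v⟫) θ x
    rw [h1, aux_div _ _ _ _ _ _ hL1 hL (hne t ht x), hLθ, hL1θ]
    have e1 : ∑ v ∈ V, (c v : ℂ) * (⟪θ, v⟫ : ℝ) *
        Complex.exp ((⟪x, v⟫ : ℝ) + ((t * ⟪θ, v⟫ : ℝ) : ℂ) * Complex.I)
        = ∑ v ∈ V, ((p v * a v : ℝ) : ℂ) * e t v :=
      Finset.sum_congr rfl fun v _ => by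
        rw [hexp]; simp only [hp, hadef]; push_cast; ring
    have e2 : ∑ v ∈ V, (c v : ℂ) * (⟪θ, v⟫ : ℝ) * (⟪θ, v⟫ : ℝ) *
        Complex.exp ((⟪x, v⟫ : ℝ) + ((t * ⟪θ, v⟫ : ℝ) : ℂ) * Complex.I)
        = ∑ v ∈ V, ((p v * a v * a v : ℝ) : ℂ) * e t v :=
      Finset.sum_congr rfl fun v _ => by
        rw [hexp]; simp only [hp, hadef]; push_cast; ring
    rw [e0, e1, e2]
  have hcont : ContinuousOn F (Set.Icc 0 1) := by
    refine ContinuousOn.div ?_ ?_ ?_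
    · exact Continuous.continuousOn (by simp only [he]; fun_prop)
    · exact Continuous.continuousOn (by simp only [he]; fun_prop)
    · intro t ht
      rw [← e0]
      exact pow_ne_zero 2 (hne t ht x)
  have hint : φ x θ = -∫ t in (0:ℝ)..1, ((1 - t : ℝ) : ℂ) * F t := by
    rw [hφ]
    congr 1
    refine intervalIntegral.integral_congr fun t ht => ?_
    rw [Set.uIcc_of_le zero_le_one] at ht
    rw [hD t ht]
  have hI : IntervalIntegrable (fun t : ℝ => ((1 - t : ℝ) : ℂ) * F t) MeasureTheory.volume 0 1 := by
    refine ContinuousOn.intervalIntegrable ?_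
    rw [Set.uIcc_of_le zero_le_one]
    exact ContinuousOn.mul (Continuous.continuousOn (by fun_prop)) hcont
  have hreint : (∫ t in (0:ℝ)..1, ((1 - t : ℝ) : ℂ) * F t).re
      = ∫ t in (0:ℝ)..1, (1 - t) * (F t).re := by
    have := Complex.reCLM.intervalIntegral_comp_comm hI
    simp only [Complex.reCLM_apply, Complex.re_ofReal_mul] at this
    exact this.symm
  have hmono : ∫ t in (0:ℝ)..1, (1 - t) * (1 / 2 * B x θ θ) ≤
      ∫ t in (0:ℝ)..1, (1 - t) * (F t).re := by
    refine intervalIntegral.integral_mono_on zero_le_one ?_ ?_ ?_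
    · exact Continuous.intervalIntegrable (by fun_prop) _ _
    · refine ContinuousOn.intervalIntegrable ?_
      rw [Set.uIcc_of_le zero_le_one]
      exact ContinuousOn.mul (Continuous.continuousOn (by fun_prop))
        (Complex.continuous_re.comp_continuousOn hcont)
    · intro t ht
      refine mul_le_mul_of_nonneg_left ?_ (by linarith [ht.2])
      rw [hBval]
      exact aux_key V hVne p a t hp0 ht.1 ht.2 ha (e t) (fun v => rfl)
  have hval : ∫ t in (0:ℝ)..1, (1 - t) * (1 / 2 * B x θ θ) = B x θ θ / 4 := by
    rw [intervalIntegral.integral_mul_const, intervalIntegral.integral_sub (by simp) (by simp)]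
    simp
    ring
  rw [hint, Complex.neg_re, hreint]
  rw [hval] at hmono
  linarith
end

section
/- There exist constants ξ > 0 and C > 0 such that for all x, y ∈ 𝔞 with ‖x − y‖ ≤ ξ: | (det B_x)^{-1/2} − (det B_y)^{-1/2} | ≤ C (det B_x)^{-1/2} ‖x − y‖, where det B_x is the determinant of the matrix of the bilinear form B_x with respect to a fixed orthonormal basis of 𝔞. -/
open scoped RealInnerProductSpace
open Finset

section Aux

lemma aux_one_le_det {r : ℕ} (Q : Matrix (Fin r) (Fin r) ℝ) (hQ : Q.PosSemidef) :
    1 ≤ (1 + Q).det := by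
  have hH : (1 + Q).PosSemidef := Matrix.PosSemidef.one.add hQ
  rw [hH.1.det_eq_prod_eigenvalues]
  have h : ∀ i, 1 ≤ hH.1.eigenvalues i := by
    intro i
    rw [hH.1.eigenvalues_eq]
    rw [Matrix.add_mulVec, dotProduct_add, Matrix.one_mulVec]
    have h1 := hQ.dotProduct_mulVec_nonneg (hH.1.eigenvectorBasis i).ofLp
    have h2 : (star (hH.1.eigenvectorBasis i).ofLp) ⬝ᵥ (hH.1.eigenvectorBasis i).ofLp = 1 := by
      have h3 := hH.1.eigenvectorBasis.orthonormal.1 i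
      have h4 : inner ℝ (hH.1.eigenvectorBasis i) (hH.1.eigenvectorBasis i) = (1 : ℝ) := by
        rw [real_inner_self_eq_norm_sq, h3]; norm_num
      rw [EuclideanSpace.inner_eq_star_dotProduct, dotProduct_comm] at h4
      exact h4
    rw [h2]
    simpa using h1
  simpa using Finset.prod_le_prod (s := Finset.univ) (f := fun _ : Fin r => (1 : ℝ))
    (g := hH.1.eigenvalues) (by simp) (fun i _ => h i)

open scoped MatrixOrder in
lemma aux_det_mono {r : ℕ} (A P : Matrix (Fin r) (Fin r) ℝ) (hA : A.PosSemidef)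
    (hP : P.PosSemidef) : A.det ≤ (A + P).det := by
  by_cases h0 : A.det = 0
  · rw [h0]; exact (hA.add hP).det_nonneg
  obtain ⟨S, hS⟩ := CStarAlgebra.nonneg_iff_eq_star_mul_self.mp
    (Matrix.nonneg_iff_posSemidef.mpr hA)
  have hSdet : S.det ≠ 0 := by
    intro h; apply h0; rw [hS, Matrix.det_mul, h, mul_zero]
  have hu : IsUnit S.det := isUnit_iff_ne_zero.mpr hSdet
  have hQ := hP.conjTranspose_mul_mul_same S⁻¹
  have key : A + P = S.conjTranspose * (1 + (S⁻¹).conjTranspose * P * S⁻¹) * S := by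
    have e1 : S⁻¹ * S = 1 := Matrix.nonsing_inv_mul S hu
    have e2 : S.conjTranspose * (S⁻¹).conjTranspose = 1 := by
      rw [← Matrix.conjTranspose_mul, e1, Matrix.conjTranspose_one]
    rw [Matrix.mul_add, Matrix.add_mul, Matrix.mul_one, ← Matrix.star_eq_conjTranspose S, ← hS]
    congr 1
    calc P = (S.conjTranspose * (S⁻¹).conjTranspose) * P * (S⁻¹ * S) := by
          rw [e1, e2]; simp
      _ = _ := by simp only [Matrix.mul_assoc, Matrix.star_eq_conjTranspose]
  have hAd : A.det = S.conjTranspose.det * S.det := by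
    conv_lhs => rw [hS, Matrix.det_mul, Matrix.star_eq_conjTranspose]
  have h1 := aux_one_le_det _ hQ
  have h2 : 0 ≤ A.det := hA.det_nonneg
  rw [key, Matrix.det_mul, Matrix.det_mul]
  nlinarith

lemma aux_gram_psd {r : ℕ} {ι : Type*} (s : Finset ι) (a : ι → Fin r → ℝ) (t : ι → ℝ)
    (ht : ∀ p ∈ s, 0 ≤ t p) :
    (∑ p ∈ s, t p • Matrix.vecMulVec (a p) (a p)).PosSemidef := by
  apply Matrix.posSemidef_sum
  intro p hp
  apply Matrix.PosSemidef.smul _ (ht p hp)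
  have := Matrix.posSemidef_vecMulVec_self_star (a p)
  simpa using this

lemma aux_gram_det {r : ℕ} {ι : Type*} (s : Finset ι) (a : ι → Fin r → ℝ) (t t' : ι → ℝ)
    (q : ℝ) (hq : 0 ≤ q) (ht : ∀ p ∈ s, 0 ≤ t p) (h : ∀ p ∈ s, q * t p ≤ t' p) :
    q ^ r * (∑ p ∈ s, t p • Matrix.vecMulVec (a p) (a p)).det ≤
      (∑ p ∈ s, t' p • Matrix.vecMulVec (a p) (a p)).det := by
  have e : (∑ p ∈ s, t' p • Matrix.vecMulVec (a p) (a p)) =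
      q • (∑ p ∈ s, t p • Matrix.vecMulVec (a p) (a p)) +
      (∑ p ∈ s, (t' p - q * t p) • Matrix.vecMulVec (a p) (a p)) := by
    rw [Finset.smul_sum, ← Finset.sum_add_distrib]
    refine Finset.sum_congr rfl fun p _ => ?_
    rw [smul_smul, ← add_smul]; congr 1; ring
  have := aux_det_mono _ _ ((aux_gram_psd s a t ht).smul hq)
    (aux_gram_psd s a (fun p => t' p - q * t p) (fun p hp => sub_nonneg.mpr (h p hp)))
  rw [e]
  rwa [Matrix.det_smul, Fintype.card_fin] at this

lemma aux_final (dx dy k δ : ℝ) (hdx : 0 ≤ dx) (hdy : 0 ≤ dy) (hk : 0 ≤ k) (hδ : 0 ≤ δ)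
    (hδ1 : δ ≤ 1) (h1 : Real.exp (-(2 * k * δ)) * dx ≤ dy)
    (h2 : Real.exp (-(2 * k * δ)) * dy ≤ dx) :
    |dx ^ (-(1 : ℝ) / 2) - dy ^ (-(1 : ℝ) / 2)| ≤
      (k * Real.exp k + 1) * dx ^ (-(1 : ℝ) / 2) * δ := by
  have hE := Real.exp_pos (-(2 * k * δ))
  rcases hdx.eq_or_lt with h0 | hx
  · have : dy = 0 := by
      rw [← h0] at h2
      nlinarith
    rw [this, ← h0, Real.zero_rpow (by norm_num)]; simp
  have hy : 0 < dy := lt_of_lt_of_le (mul_pos hE hx) h1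
  have aux : ∀ u v : ℝ, 0 < u → 0 < v → Real.exp (-(2 * k * δ)) * u ≤ v →
      v ^ (-(1 : ℝ) / 2) ≤ Real.exp (k * δ) * u ^ (-(1 : ℝ) / 2) := by
    intro u v hu hv h
    have := Real.rpow_le_rpow_of_nonpos (mul_pos hE hu) h (z := -(1 : ℝ) / 2) (by norm_num)
    rw [Real.mul_rpow hE.le hu.le, ← Real.exp_mul] at this
    convert this using 3
    ring
  have a1 := aux dx dy hx hy h1
  have a2 := aux dy dx hy hx h2
  have px : 0 < dx ^ (-(1 : ℝ) / 2) := Real.rpow_pos_of_pos hx _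
  have py : 0 < dy ^ (-(1 : ℝ) / 2) := Real.rpow_pos_of_pos hy _
  generalize dx ^ (-(1 : ℝ) / 2) = a at *
  generalize dy ^ (-(1 : ℝ) / 2) = a' at *
  have hexp : Real.exp (k * δ) - 1 ≤ k * Real.exp k * δ := by
    have e1 : 1 - k * δ ≤ Real.exp (-(k * δ)) := by
      have := Real.add_one_le_exp (-(k * δ)); linarith
    have e2 : Real.exp (k * δ) * Real.exp (-(k * δ)) = 1 := by
      rw [← Real.exp_add]; simp
    have e3 : Real.exp (k * δ) ≤ Real.exp k := Real.exp_le_exp.mpr (by nlinarith)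
    have e4 := mul_le_mul_of_nonneg_left e1 (Real.exp_pos (k * δ)).le
    have e5 := mul_le_mul_of_nonneg_left e3 (mul_nonneg hk hδ)
    nlinarith
  have hone : 1 ≤ Real.exp (k * δ) := Real.one_le_exp (mul_nonneg hk hδ)
  have hfin : (Real.exp (k * δ) - 1) * a ≤ (k * Real.exp k + 1) * a * δ := by
    have := mul_le_mul_of_nonneg_right hexp px.le
    nlinarith [mul_nonneg px.le hδ]
  refine le_trans ?_ hfin
  rw [abs_le]
  generalize Real.exp (k * δ) = e at *
  constructor
  · linarith
  · by_cases h : a ≤ a'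
    · nlinarith
    · nlinarith

variable {E : Type*} [NormedAddCommGroup E] [InnerProductSpace ℝ E]

lemma aux_deriv_sum (V : Finset E) (d : E → ℝ) (x : E) :
    HasFDerivAt (fun z : E => ∑ v ∈ V, d v * Real.exp ⟪z, v⟫)
      (∑ v ∈ V, (d v * Real.exp ⟪x, v⟫) • innerSL ℝ v) x := by
  apply HasFDerivAt.fun_sum
  intro v _
  have h : HasFDerivAt (fun z : E => ⟪z, v⟫) (innerSL ℝ v) x := by
    have := (innerSL ℝ v).hasFDerivAt (x := x)
    refine this.congr_of_eventuallyEq (Filter.Eventually.of_forall fun z => ?_)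
    simp [real_inner_comm]
  have := (h.exp).const_mul (d v)
  rwa [smul_smul] at this

lemma aux_hess (V : Finset E) (c : E → ℝ) (κ : E → ℝ)
    (hκ : ∀ x, κ x = ∑ v ∈ V, c v * Real.exp ⟪x, v⟫) (hpos : ∀ x, 0 < κ x) (x u u' : E) :
    fderiv ℝ (fun y => fderiv ℝ (fun z => Real.log (κ z)) y u') x u =
    ∑ p ∈ V ×ˢ V, ((1 / 2) * (c p.1 * Real.exp ⟪x, p.1⟫ / κ x) *
      (c p.2 * Real.exp ⟪x, p.2⟫ / κ x)) * (⟪u, p.1 - p.2⟫ * ⟪u', p.1 - p.2⟫) := by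
  have hκd : ∀ y, HasFDerivAt κ (∑ v ∈ V, (c v * Real.exp ⟪y, v⟫) • innerSL ℝ v) y := by
    intro y
    have := aux_deriv_sum V c y
    rwa [← funext hκ] at this
  have h1 : (fun y => fderiv ℝ (fun z => Real.log (κ z)) y u') =
      fun y => (∑ v ∈ V, (c v * ⟪v, u'⟫) * Real.exp ⟪y, v⟫) * (κ y)⁻¹ := by
    funext y
    rw [((hκd y).log (hpos y).ne').fderiv]
    simp only [smul_apply, _root_.sum_apply, smul_eq_mul,
      innerSL_apply_apply]
    rw [mul_comm]
    congr 1
    exact Finset.sum_congr rfl fun v _ => by ring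
  have hinv : HasFDerivAt (fun y => (κ y)⁻¹) _ x :=
    (hasDerivAt_inv (hpos x).ne').comp_hasFDerivAt x (hκd x)
  rw [h1, ((aux_deriv_sum V (fun v => c v * ⟪v, u'⟫) x).fun_mul hinv).fderiv]
  simp only [ContinuousLinearMap.add_apply, smul_apply,
    _root_.sum_apply, smul_eq_mul, innerSL_apply_apply]
  have hk := (hpos x).ne'
  have key : ∑ p ∈ V ×ˢ V, ((1 / 2) * (c p.1 * Real.exp ⟪x, p.1⟫ / κ x) *
      (c p.2 * Real.exp ⟪x, p.2⟫ / κ x)) * (⟪u, p.1 - p.2⟫ * ⟪u', p.1 - p.2⟫) =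
      (1 / κ x ^ 2) * ((∑ v ∈ V, c v * Real.exp ⟪x, v⟫) *
        (∑ v ∈ V, c v * Real.exp ⟪x, v⟫ * (⟪v, u⟫ * ⟪v, u'⟫)) -
        (∑ v ∈ V, c v * Real.exp ⟪x, v⟫ * ⟪v, u⟫) *
        (∑ v ∈ V, c v * Real.exp ⟪x, v⟫ * ⟪v, u'⟫)) := by
    set f : E → ℝ := fun v => c v * Real.exp ⟪x, v⟫ with hf
    have s1 : ∑ p ∈ V ×ˢ V, ((1 / 2) * (c p.1 * Real.exp ⟪x, p.1⟫ / κ x) *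
      (c p.2 * Real.exp ⟪x, p.2⟫ / κ x)) * (⟪u, p.1 - p.2⟫ * ⟪u', p.1 - p.2⟫) =
      ∑ v ∈ V, ∑ w ∈ V, (1 / κ x ^ 2) * (1 / 2) * (f v * (f w * (⟪w, u⟫ * ⟪w, u'⟫))
        + (f v * (⟪v, u⟫ * ⟪v, u'⟫)) * f w - (f v * ⟪v, u⟫) * (f w * ⟪w, u'⟫)
        - (f v * ⟪v, u'⟫) * (f w * ⟪w, u⟫)) := by
      rw [Finset.sum_product]
      refine Finset.sum_congr rfl fun v _ => Finset.sum_congr rfl fun w _ => ?_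
      simp only [hf, inner_sub_right, real_inner_comm u, real_inner_comm u']
      field_simp
      ring
    rw [s1]
    simp only [← Finset.mul_sum, Finset.sum_add_distrib, Finset.sum_sub_distrib,
      ← Finset.sum_mul]
    ring
  rw [key, ← hκ]
  have t1 : ∑ v ∈ V, c v * ⟪v, u'⟫ * Real.exp ⟪x, v⟫ * ⟪v, u⟫ =
      ∑ v ∈ V, c v * Real.exp ⟪x, v⟫ * (⟪v, u⟫ * ⟪v, u'⟫) :=
    Finset.sum_congr rfl fun v _ => by ring
  have t2 : ∑ v ∈ V, c v * ⟪v, u'⟫ * Real.exp ⟪x, v⟫ =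
      ∑ v ∈ V, c v * Real.exp ⟪x, v⟫ * ⟪v, u'⟫ :=
    Finset.sum_congr rfl fun v _ => by ring
  rw [t1, t2]
  field_simp
  ring

lemma aux_weight (V : Finset E) (c : E → ℝ) (hc : ∀ v ∈ V, 0 < c v) (κ : E → ℝ)
    (hκ : ∀ x, κ x = ∑ v ∈ V, c v * Real.exp ⟪x, v⟫) (hpos : ∀ x, 0 < κ x) (R : ℝ)
    (hR : ∀ v ∈ V, ‖v‖ ≤ R) (x y v : E) (hv : v ∈ V) :
    Real.exp (-(2 * R * ‖x - y‖)) * (c v * Real.exp ⟪x, v⟫ / κ x) ≤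
      c v * Real.exp ⟪y, v⟫ / κ y := by
  have hin : ∀ w ∈ V, |⟪x - y, w⟫| ≤ R * ‖x - y‖ := fun w hw =>
    (abs_real_inner_le_norm _ _).trans (by
      rw [mul_comm]; exact mul_le_mul_of_nonneg_right (hR w hw) (norm_nonneg _))
  have hk : κ y ≤ Real.exp (R * ‖x - y‖) * κ x := by
    rw [hκ, hκ, Finset.mul_sum]
    refine Finset.sum_le_sum fun w hw => ?_
    rw [mul_left_comm, ← Real.exp_add]
    refine mul_le_mul_of_nonneg_left (Real.exp_le_exp.mpr ?_) (hc w hw).le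
    have := (abs_le.mp (hin w hw)).1
    rw [inner_sub_left] at this
    linarith
  have he : Real.exp (-(R * ‖x - y‖)) * Real.exp ⟪x, v⟫ ≤ Real.exp ⟪y, v⟫ := by
    rw [← Real.exp_add]
    refine Real.exp_le_exp.mpr ?_
    have := (abs_le.mp (hin v hv)).2
    rw [inner_sub_left] at this
    linarith
  rw [← mul_div_assoc, div_le_div_iff₀ (hpos x) (hpos y)]
  have e2 : Real.exp (-(2 * R * ‖x - y‖)) * Real.exp (R * ‖x - y‖) =
      Real.exp (-(R * ‖x - y‖)) := by
    rw [← Real.exp_add]; congr 1; ring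
  have hcv := hc v hv
  have hkx := hpos x
  calc Real.exp (-(2 * R * ‖x - y‖)) * (c v * Real.exp ⟪x, v⟫) * κ y
      ≤ Real.exp (-(2 * R * ‖x - y‖)) * (c v * Real.exp ⟪x, v⟫) *
        (Real.exp (R * ‖x - y‖) * κ x) := by gcongr
    _ = c v * κ x * (Real.exp (-(R * ‖x - y‖)) * Real.exp ⟪x, v⟫) := by rw [← e2]; ring
    _ ≤ c v * κ x * Real.exp ⟪y, v⟫ := by gcongr
    _ = _ := by ring

end Aux

/-- There exist `ξ > 0` and `C > 0` such that for all `x, y` with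
`‖x - y‖ ≤ ξ`: `|(det B_x)^{-1/2} - (det B_y)^{-1/2}| ≤ C (det B_x)^{-1/2} ‖x - y‖`, where
`det B_x` is the determinant of the matrix of the Hessian bilinear form `B_x` of `log κ` at
`x` with respect to a fixed orthonormal basis of `E`. -/
theorem statement14 {r : ℕ} {E : Type*} [NormedAddCommGroup E] [InnerProductSpace ℝ E]
    [FiniteDimensional ℝ E]
    (V : Finset E) (hspan : Submodule.span ℝ (V : Set E) = ⊤)
    (c : E → ℝ) (hc : ∀ v ∈ V, 0 < c v) (hcsum : ∑ v ∈ V, c v = 1)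
    (κ : E → ℝ) (hκ : ∀ x, κ x = ∑ v ∈ V, c v * Real.exp ⟪x, v⟫)
    (B : E → E → E → ℝ)
    (hB : ∀ x u u', B x u u' =
      fderiv ℝ (fun y => fderiv ℝ (fun z => Real.log (κ z)) y u') x u)
    (b : OrthonormalBasis (Fin r) ℝ E)
    (detB : E → ℝ)
    (hdetB : ∀ x, detB x = Matrix.det (Matrix.of fun i j => B x (b i) (b j))) :
    ∃ ξ > (0 : ℝ), ∃ C > (0 : ℝ), ∀ x y : E, ‖x - y‖ ≤ ξ →
      |detB x ^ (-(1 : ℝ) / 2) - detB y ^ (-(1 : ℝ) / 2)|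
        ≤ C * detB x ^ (-(1 : ℝ) / 2) * ‖x - y‖ := by
  have hne : V.Nonempty := by
    rcases V.eq_empty_or_nonempty with h | h
    · rw [h] at hcsum; simp at hcsum
    · exact h
  have hpos : ∀ x, 0 < κ x := fun x => by
    rw [hκ]; exact Finset.sum_pos (fun v hv => mul_pos (hc v hv) (Real.exp_pos _)) hne
  let R : ℝ := ∑ v ∈ V, ‖v‖
  have hR : ∀ v ∈ V, ‖v‖ ≤ R := fun v hv =>
    Finset.single_le_sum (f := fun v : E => ‖v‖) (fun _ _ => norm_nonneg _) hv
  have hR0 : 0 ≤ R := Finset.sum_nonneg fun _ _ => norm_nonneg _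
  let t : E → E × E → ℝ := fun x p => (1 / 2) * (c p.1 * Real.exp ⟪x, p.1⟫ / κ x) *
      (c p.2 * Real.exp ⟪x, p.2⟫ / κ x)
  let a : E × E → Fin r → ℝ := fun p i => ⟪b i, p.1 - p.2⟫
  have hw0 : ∀ x, ∀ v ∈ V, 0 ≤ c v * Real.exp ⟪x, v⟫ / κ x := fun x v hv =>
    div_nonneg (mul_nonneg (hc v hv).le (Real.exp_pos _).le) (hpos x).le
  have ht : ∀ x, ∀ p ∈ V ×ˢ V, 0 ≤ t x p := fun x p hp => by
    rw [Finset.mem_product] at hp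
    exact mul_nonneg (mul_nonneg (by norm_num) (hw0 x _ hp.1)) (hw0 x _ hp.2)
  have hdet : ∀ x, detB x = (∑ p ∈ V ×ˢ V, t x p • Matrix.vecMulVec (a p) (a p)).det := by
    intro x
    rw [hdetB]
    congr 1
    ext i j
    rw [Matrix.of_apply, hB, aux_hess V c κ hκ hpos, Matrix.sum_apply]
    rfl
  have hd0 : ∀ x, 0 ≤ detB x := fun x => by
    rw [hdet]; exact (aux_gram_psd _ a (t x) (ht x)).det_nonneg
  have hcomp : ∀ x y, Real.exp (-(2 * (2 * R * r) * ‖x - y‖)) * detB x ≤ detB y := by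
    intro x y
    have := aux_gram_det (V ×ˢ V) a (t x) (t y) (Real.exp (-(4 * R * ‖x - y‖)))
      (Real.exp_pos _).le (ht x) (by
        intro p hp
        rw [Finset.mem_product] at hp
        have h1 := aux_weight V c hc κ hκ hpos R hR x y p.1 hp.1
        have h2 := aux_weight V c hc κ hκ hpos R hR x y p.2 hp.2
        have h3 := mul_le_mul h1 h2 (mul_nonneg (Real.exp_pos _).le (hw0 x _ hp.2))
          (hw0 y _ hp.1)
        have e : Real.exp (-(4 * R * ‖x - y‖)) =
            Real.exp (-(2 * R * ‖x - y‖)) * Real.exp (-(2 * R * ‖x - y‖)) := by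
          rw [← Real.exp_add]; congr 1; ring
        rw [e]
        simp only [t]
        linarith)
    rw [← hdet, ← hdet, ← Real.exp_nat_mul] at this
    convert this using 3
    ring
  have hk0 : 0 ≤ 2 * R * r := by positivity
  refine ⟨1, one_pos, 2 * R * r * Real.exp (2 * R * r) + 1, by positivity, fun x y hxy => ?_⟩
  refine aux_final _ _ _ _ (hd0 x) (hd0 y) hk0 (norm_nonneg _) hxy (hcomp x y) ?_
  rw [norm_sub_rev]
  exact hcomp y x
end

section
/- Let α ∈ 𝔞, α ≠ 0, let α̌ = 2α/⟨α,α⟩, and let r_α be the orthogonal reflection r_α(x) = x − ⟨α̌, x⟩ α. Assume κ(r_α x) = κ(x) for all x ∈ 𝔞. Then there exist constants ξ > 0 and C > 0 such that for every x₀ ∈ 𝔞 with r_α x₀ = x₀ and every x ∈ 𝔞 with ‖x − x₀‖ ≤ ξ: | D_α log κ(x) − B_{x₀}(α, x) | ≤ C | B_{x₀}(α, x) | ‖x − x₀‖, where D_α log κ(x) is the directional derivative of log κ at x in the direction α. -/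
open scoped RealInnerProductSpace
open Finset

section helpers
variable {E : Type*} [NormedAddCommGroup E] [InnerProductSpace ℝ E]

/-- Weighted exponential sums. -/
noncomputable def wsum (V : Finset E) (a : E → ℝ) (x : E) : ℝ :=
  ∑ v ∈ V, a v * Real.exp ⟪x, v⟫

lemma wsum_hasFDerivAt (V : Finset E) (a : E → ℝ) (x : E) :
    HasFDerivAt (wsum V a) (∑ v ∈ V, (a v * Real.exp ⟪x, v⟫) • innerSL ℝ v) x := by
  unfold wsum
  apply HasFDerivAt.fun_sum
  intro v _
  have h1 : HasFDerivAt (fun y : E => ⟪y, v⟫) (innerSL ℝ v) x := by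
    have := (innerSL ℝ v).hasFDerivAt (x := x)
    refine this.congr_of_eventuallyEq (Filter.Eventually.of_forall fun y => ?_)
    simp [real_inner_comm]
  have := (h1.exp).const_mul (a v)
  rwa [smul_smul] at this

lemma wsum_fderiv_apply (V : Finset E) (a : E → ℝ) (x u : E) :
    (∑ v ∈ V, (a v * Real.exp ⟪x, v⟫) • innerSL ℝ v) u
      = wsum V (fun v => a v * ⟪u, v⟫) x := by
  simp only [_root_.sum_apply, wsum]
  refine Finset.sum_congr rfl fun v _ => ?_
  simp [real_inner_comm]
  ring

lemma wsum_line (V : Finset E) (a : E → ℝ) (x u : E) (s : ℝ) :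
    HasDerivAt (fun s : ℝ => wsum V a (x + s • u))
      (wsum V (fun v => a v * ⟪u, v⟫) (x + s • u)) s := by
  have h := wsum_hasFDerivAt V a (x + s • u)
  have h2 : HasDerivAt (fun s : ℝ => x + s • u) u s := by
    simpa using ((hasDerivAt_id s).smul_const u).const_add x
  have := h.comp_hasDerivAt s h2
  rwa [wsum_fderiv_apply] at this

/-- Variance as a double sum. -/
lemma var_eq (V : Finset E) (a : E → ℝ) (α x : E) :
    wsum V (fun v => a v * ⟪α, v⟫ * ⟪α, v⟫) x * wsum V a x
      - wsum V (fun v => a v * ⟪α, v⟫) x ^ 2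
    = ∑ v ∈ V, ∑ w ∈ V, (a v * a w * (⟪α, v⟫ - ⟪α, w⟫) ^ 2 / 2) * Real.exp (⟪x, v⟫ + ⟪x, w⟫) := by
  have h1 : wsum V (fun v => a v * ⟪α, v⟫ * ⟪α, v⟫) x * wsum V a x = 
      ∑ v ∈ V, ∑ w ∈ V, (a v * ⟪α, v⟫ * ⟪α, v⟫ * Real.exp ⟪x, v⟫) * (a w * Real.exp ⟪x, w⟫) := by
    simp only [wsum, Finset.sum_mul_sum]
  have h2 : wsum V (fun v => a v * ⟪α, v⟫ * ⟪α, v⟫) x * wsum V a x = 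
      ∑ v ∈ V, ∑ w ∈ V, (a w * ⟪α, w⟫ * ⟪α, w⟫ * Real.exp ⟪x, w⟫) * (a v * Real.exp ⟪x, v⟫) := by
    rw [h1, Finset.sum_comm]
  have h3 : wsum V (fun v => a v * ⟪α, v⟫) x ^ 2 = 
      ∑ v ∈ V, ∑ w ∈ V, (a v * ⟪α, v⟫ * Real.exp ⟪x, v⟫) * (a w * ⟪α, w⟫ * Real.exp ⟪x, w⟫) := by
    simp only [wsum, sq, Finset.sum_mul_sum]
  have h4 : wsum V (fun v => a v * ⟪α, v⟫ * ⟪α, v⟫) x * wsum V a x =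
    (wsum V (fun v => a v * ⟪α, v⟫ * ⟪α, v⟫) x * wsum V a x) / 2 
    + (wsum V (fun v => a v * ⟪α, v⟫ * ⟪α, v⟫) x * wsum V a x) / 2 := by ring
  rw [h4]
  nth_rewrite 1 [h1]
  rw [h2, h3]
  simp only [Finset.sum_div, ← Finset.sum_add_distrib, ← Finset.sum_sub_distrib]
  refine Finset.sum_congr rfl fun v _ => Finset.sum_congr rfl fun w _ => ?_
  rw [Real.exp_add]
  ring

lemma inner_diff_le (V : Finset E) {v : E} (hv : v ∈ V) (x y : E) :
    ⟪x, v⟫ ≤ ⟪y, v⟫ + (∑ v ∈ V, ‖v‖) * ‖x - y‖ := by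
  have h1 : ⟪x, v⟫ - ⟪y, v⟫ ≤ ‖x - y‖ * ‖v‖ := by
    rw [← inner_sub_left]; exact real_inner_le_norm _ _
  have h2 : ‖v‖ ≤ ∑ v ∈ V, ‖v‖ :=
    Finset.single_le_sum (f := fun v => ‖v‖) (fun _ _ => norm_nonneg _) hv
  nlinarith [norm_nonneg (x - y)]

lemma wsum_le (V : Finset E) (a : E → ℝ) (ha : ∀ v ∈ V, 0 ≤ a v) (x y : E) :
    wsum V a x ≤ Real.exp ((∑ v ∈ V, ‖v‖) * ‖x - y‖) * wsum V a y := by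
  unfold wsum
  rw [Finset.mul_sum]
  refine Finset.sum_le_sum fun v hv => ?_
  have := Real.exp_le_exp.2 (inner_diff_le V hv x y)
  rw [Real.exp_add] at this
  have := mul_le_mul_of_nonneg_left this (ha v hv)
  linarith

/-- The variance. -/
noncomputable def wvar (V : Finset E) (a : E → ℝ) (α x : E) : ℝ :=
  wsum V (fun v => a v * ⟪α, v⟫ * ⟪α, v⟫) x * wsum V a x
      - wsum V (fun v => a v * ⟪α, v⟫) x ^ 2

lemma wvar_nonneg (V : Finset E) (a : E → ℝ) (ha : ∀ v ∈ V, 0 ≤ a v) (α x : E) :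
    0 ≤ wvar V a α x := by
  rw [wvar, var_eq]
  refine Finset.sum_nonneg fun v hv => Finset.sum_nonneg fun w hw => ?_
  have := ha v hv
  have := ha w hw
  positivity

lemma wvar_le (V : Finset E) (a : E → ℝ) (ha : ∀ v ∈ V, 0 ≤ a v) (α x y : E) :
    wvar V a α x ≤ Real.exp ((∑ v ∈ V, ‖v‖) * ‖x - y‖) ^ 2 * wvar V a α y := by
  rw [wvar, wvar, var_eq, var_eq, Finset.mul_sum]
  refine Finset.sum_le_sum fun v hv => ?_
  rw [Finset.mul_sum]
  refine Finset.sum_le_sum fun w hw => ?_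
  have h1 := inner_diff_le V hv x y
  have h2 := inner_diff_le V hw x y
  have h3 := Real.exp_le_exp.2 (add_le_add h1 h2)
  have hc : 0 ≤ a v * a w * (⟪α, v⟫ - ⟪α, w⟫) ^ 2 / 2 := by
    have := ha v hv
    have := ha w hw
    positivity
  have h4 := mul_le_mul_of_nonneg_left h3 hc
  refine h4.trans (le_of_eq ?_)
  simp only [Real.exp_add]
  ring

lemma ratio_le (V : Finset E) (a : E → ℝ) (ha : ∀ v ∈ V, 0 ≤ a v)
    (hpos : ∀ x, 0 < wsum V a x) (α x y : E) :
    wvar V a α x / wsum V a x ^ 2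
      ≤ Real.exp (4 * (∑ v ∈ V, ‖v‖) * ‖x - y‖) * (wvar V a α y / wsum V a y ^ 2) := by
  have h1 := wvar_le V a ha α x y
  have h2 := wsum_le V a ha y x
  rw [norm_sub_rev] at h2
  have hE : Real.exp (4 * (∑ v ∈ V, ‖v‖) * ‖x - y‖)
      = Real.exp ((∑ v ∈ V, ‖v‖) * ‖x - y‖) ^ 4 := by
    rw [← Real.exp_nat_mul]; congr 1; push_cast; ring
  rw [hE]
  set e := Real.exp ((∑ v ∈ V, ‖v‖) * ‖x - y‖) with he
  have hepos : 0 < e := Real.exp_pos _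
  have hx := hpos x
  have hy := hpos y
  have hv := wvar_nonneg V a ha α y
  rw [mul_div_assoc', div_le_div_iff₀ (by positivity) (by positivity)]
  have h3 : wsum V a y ^ 2 ≤ (e * wsum V a x) ^ 2 := pow_le_pow_left₀ hy.le h2 2
  calc _ ≤ (e ^ 2 * wvar V a α y) * (e * wsum V a x) ^ 2 := by gcongr
    _ = _ := by ring

lemma ratio_diff (V : Finset E) (a : E → ℝ) (ha : ∀ v ∈ V, 0 ≤ a v)
    (hpos : ∀ x, 0 < wsum V a x) (α x y : E) (d : ℝ) (hd1 : d ≤ 1) (hd : ‖x - y‖ ≤ d) :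
    |wvar V a α x / wsum V a x ^ 2 - wvar V a α y / wsum V a y ^ 2|
      ≤ (4 * (∑ v ∈ V, ‖v‖) * Real.exp (4 * (∑ v ∈ V, ‖v‖))) * d
        * (wvar V a α y / wsum V a y ^ 2) := by
  have h1 := ratio_le V a ha hpos α x y
  have h2 := ratio_le V a ha hpos α y x
  rw [norm_sub_rev] at h2
  have hM : 0 ≤ 4 * ∑ v ∈ V, ‖v‖ := by positivity
  have hby : 0 ≤ wvar V a α y / wsum V a y ^ 2 :=
    div_nonneg (wvar_nonneg V a ha α y) (by positivity)
  have hbx : 0 ≤ wvar V a α x / wsum V a x ^ 2 :=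
    div_nonneg (wvar_nonneg V a ha α x) (by positivity)
  set M := 4 * ∑ v ∈ V, ‖v‖
  set p := wvar V a α x / wsum V a x ^ 2
  set q := wvar V a α y / wsum V a y ^ 2
  have hd0 : 0 ≤ d := (norm_nonneg _).trans hd
  have hle : Real.exp (M * ‖x - y‖) ≤ Real.exp (M * d) := by gcongr
  have hle1 : Real.exp (M * d) ≤ Real.exp M := by
    apply Real.exp_le_exp.2; nlinarith
  have hmd : 0 ≤ M * d := by positivity
  have hA : Real.exp (M * d) - 1 ≤ M * d * Real.exp (M * d) := by
    have := Real.add_one_le_exp (-(M * d))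
    have h3 : Real.exp (-(M * d)) * Real.exp (M * d) = 1 := by
      rw [← Real.exp_add]; simp
    nlinarith [Real.exp_pos (M * d)]
  have hB : Real.exp (M * d) - 1 ≤ M * Real.exp M * d := by nlinarith
  have hp : p ≤ Real.exp (M * d) * q := h1.trans (by gcongr)
  have hq : q ≤ Real.exp (M * d) * p := h2.trans (by gcongr)
  rw [abs_le]
  constructor
  · have h5 : q * (1 - M * d) ≤ p := by
      have := Real.add_one_le_exp (-(M * d))
      have h3 : Real.exp (-(M * d)) * Real.exp (M * d) = 1 := by
        rw [← Real.exp_add]; simp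
      have h6 : Real.exp (-(M * d)) * q ≤ p := by
        calc _ ≤ Real.exp (-(M * d)) * (Real.exp (M * d) * p) := by gcongr
          _ = p := by rw [← mul_assoc, h3, one_mul]
      nlinarith
    have h7 : 1 ≤ Real.exp M := Real.one_le_exp hM
    have h8 : M * d * q ≤ Real.exp M * (M * d * q) := le_mul_of_one_le_left (by positivity) h7
    nlinarith
  · nlinarith

end helpers

/-- Let `α ≠ 0`, `α̌ = 2α/⟪α,α⟫`, and let `r_α x = x - ⟪α̌, x⟫ α` be the
orthogonal reflection.  Assume `κ ∘ r_α = κ`.  Then there are `ξ > 0` and `C > 0` such that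
for every `x₀` with `r_α x₀ = x₀` and every `x` with `‖x - x₀‖ ≤ ξ`:
`|D_α log κ (x) - B_{x₀}(α, x)| ≤ C |B_{x₀}(α, x)| ‖x - x₀‖`. -/
theorem statement15 {E : Type*} [NormedAddCommGroup E] [InnerProductSpace ℝ E]
    [FiniteDimensional ℝ E]
    (V : Finset E) (hspan : Submodule.span ℝ (V : Set E) = ⊤)
    (c : E → ℝ) (hc : ∀ v ∈ V, 0 < c v) (hcsum : ∑ v ∈ V, c v = 1)
    (κ : E → ℝ) (hκ : ∀ x, κ x = ∑ v ∈ V, c v * Real.exp ⟪x, v⟫)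
    (B : E → E → E → ℝ)
    (hB : ∀ x u u', B x u u' =
      fderiv ℝ (fun y => fderiv ℝ (fun z => Real.log (κ z)) y u') x u)
    (α : E) (hα : α ≠ 0)
    (hrefl : ∀ x : E, κ (x - ⟪(2 / ⟪α, α⟫) • α, x⟫ • α) = κ x) :
    ∃ ξ > (0 : ℝ), ∃ C > (0 : ℝ), ∀ x₀ : E,
      x₀ - ⟪(2 / ⟪α, α⟫) • α, x₀⟫ • α = x₀ →
      ∀ x : E, ‖x - x₀‖ ≤ ξ →
        |fderiv ℝ (fun y => Real.log (κ y)) x α - B x₀ α x|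
          ≤ C * |B x₀ α x| * ‖x - x₀‖ := by
  have hκw : κ = wsum V c := by funext x; rw [hκ]; rfl
  have hne : V.Nonempty := by
    rw [Finset.nonempty_iff_ne_empty]; rintro rfl; simp at hcsum
  have hpos : ∀ x, 0 < wsum V c x := fun x =>
    Finset.sum_pos (fun v hv => mul_pos (hc v hv) (Real.exp_pos _)) hne
  have ha : ∀ v ∈ V, 0 ≤ c v := fun v hv => (hc v hv).le
  have hαα : ⟪α, α⟫ ≠ 0 := by simpa using hα
  subst hκw
  -- first derivative
  have hD : ∀ z u, fderiv ℝ (fun y => Real.log (wsum V c y)) z u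
      = wsum V (fun v => c v * ⟪u, v⟫) z / wsum V c z := by
    intro z u
    rw [((wsum_hasFDerivAt V c z).log (hpos z).ne').fderiv, _root_.smul_apply,
      wsum_fderiv_apply, smul_eq_mul]
    field_simp
  -- vanishing on the hyperplane
  have hS0 : ∀ z, ⟪α, z⟫ = 0 → wsum V (fun v => c v * ⟪α, v⟫) z = 0 := by
    intro z hz
    have h1 := wsum_line V c z α 0
    have h2 : HasDerivAt (fun s : ℝ => wsum V c (z + s • α))
        (-wsum V (fun v => c v * ⟪α, v⟫) z) 0 := by
      have h3 := wsum_line V c z α (-0)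
      have h4 := h3.scomp (0 : ℝ) (hasDerivAt_neg (0 : ℝ))
      have h5 : (fun s : ℝ => wsum V c (z + s • α)) =
          (fun s : ℝ => wsum V c (z + s • α)) ∘ (fun s => -s) := by
        funext s
        simp only [Function.comp]
        rw [← hrefl (z + s • α)]
        congr 1
        rw [inner_smul_left, inner_add_right, hz, inner_smul_right]
        simp only [zero_add, conj_trivial]
        rw [show 2 / ⟪α, α⟫ * (s * ⟪α, α⟫) = 2 * s by field_simp]
        module
      rw [h5]
      simpa using h4
    have := h1.unique h2
    simp at this
    linarith
  have hT0 : ∀ z y, ⟪α, z⟫ = 0 → ⟪α, y⟫ = 0 →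
      wsum V (fun v => c v * ⟪α, v⟫ * ⟪y, v⟫) z = 0 := by
    intro z y hz hy
    have h1 := wsum_line V (fun v => c v * ⟪α, v⟫) z y 0
    have h2 : (fun s : ℝ => wsum V (fun v => c v * ⟪α, v⟫) (z + s • y)) = fun _ => 0 := by
      funext s
      apply hS0
      rw [inner_add_right, inner_smul_right, hz, hy]; simp
    rw [h2] at h1
    have := h1.unique (hasDerivAt_const (0 : ℝ) (0 : ℝ))
    simpa using this
  refine ⟨1, one_pos, 4 * (∑ v ∈ V, ‖v‖) * Real.exp (4 * (∑ v ∈ V, ‖v‖)) + 1, by positivity, ?_⟩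
  intro x₀ hx₀ x hx
  have hx0 : ⟪α, x₀⟫ = 0 := by
    have h1 : ⟪(2 / ⟪α, α⟫) • α, x₀⟫ • α = 0 := by simpa using hx₀
    have h2 := (smul_eq_zero.1 h1).resolve_right hα
    rw [inner_smul_left] at h2
    have h3 : (2 / ⟪α, α⟫) ≠ 0 := by positivity
    simpa [hα] using h2
  -- decomposition
  obtain ⟨t, y, hy, rfl⟩ : ∃ (t : ℝ) (y : E), ⟪α, y⟫ = 0 ∧ x = y + t • α := by
    refine ⟨⟪α, x⟫ / ⟪α, α⟫, x - (⟪α, x⟫ / ⟪α, α⟫) • α, ?_, by simp⟩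
    rw [inner_sub_right, inner_smul_right]; field_simp; ring
  set b := wvar V c α x₀ / wsum V c x₀ ^ 2 with hb
  have hb0 : 0 ≤ b := div_nonneg (wvar_nonneg V c ha α x₀) (by positivity)
  have hBx : B x₀ α (y + t • α) = t * b := by
    rw [hB]
    have hfun : (fun z => fderiv ℝ (fun z => Real.log (wsum V c z)) z (y + t • α))
        = fun z => wsum V (fun v => c v * ⟪y + t • α, v⟫) z / wsum V c z := by
      funext z; exact hD z _
    rw [hfun]
    have hdiff : DifferentiableAt ℝ
        (fun z => wsum V (fun v => c v * ⟪y + t • α, v⟫) z / wsum V c z) x₀ := by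
      have e1 := (wsum_hasFDerivAt V (fun v => c v * ⟪y + t • α, v⟫) x₀).differentiableAt
      have e2 := (wsum_hasFDerivAt V c x₀).differentiableAt
      have e3 := (hpos x₀).ne'
      simp only [div_eq_mul_inv]
      exact e1.fun_mul ((differentiableAt_inv e3).comp x₀ e2)
    rw [← hdiff.lineDeriv_eq_fderiv, lineDeriv,
      ((wsum_line V (fun v => c v * ⟪y + t • α, v⟫) x₀ α 0).fun_div (wsum_line V c x₀ α 0)
        (hpos _).ne').deriv]
    simp only [zero_smul, add_zero]
    rw [hS0 x₀ hx0, hb, wvar, hS0 x₀ hx0]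
    have : wsum V (fun v => c v * ⟪y + t • α, v⟫ * ⟪α, v⟫) x₀
        = wsum V (fun v => c v * ⟪α, v⟫ * ⟪y, v⟫) x₀
          + t * wsum V (fun v => c v * ⟪α, v⟫ * ⟪α, v⟫) x₀ := by
      simp only [wsum, Finset.mul_sum, ← Finset.sum_add_distrib]
      refine Finset.sum_congr rfl fun v _ => ?_
      rw [inner_add_left, inner_smul_left]
      simp only [conj_trivial]
      ring
    rw [this, hT0 x₀ y hx0 hy]
    ring
  rw [hBx, hD]
  set d := ‖y + t • α - x₀‖ with hd
  set K := 4 * (∑ v ∈ V, ‖v‖) * Real.exp (4 * (∑ v ∈ V, ‖v‖)) with hK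
  have hderiv : ∀ s : ℝ, HasDerivAt
      (fun s : ℝ => wsum V (fun v => c v * ⟪α, v⟫) (y + s • α) / wsum V c (y + s • α) - s * b)
      (wvar V c α (y + s • α) / wsum V c (y + s • α) ^ 2 - b) s := by
    intro s
    have h1 := (wsum_line V (fun v => c v * ⟪α, v⟫) y α s).fun_div (wsum_line V c y α s)
      (hpos _).ne'
    have h2 := h1.fun_sub ((hasDerivAt_id s).mul_const b)
    refine h2.congr_deriv ?_
    rw [wvar]; ring
  have hnorm : ∀ s : ℝ, ‖y + s • α - x₀‖ ^ 2 = ‖y - x₀‖ ^ 2 + s ^ 2 * ‖α‖ ^ 2 := by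
    intro s
    rw [show y + s • α - x₀ = (y - x₀) + s • α by abel, norm_add_sq_real, inner_smul_right,
      real_inner_comm, inner_sub_right, hy, hx0, norm_smul, mul_pow, Real.norm_eq_abs, sq_abs]
    ring
  have hbound : ∀ s ∈ Set.Icc (-|t|) |t|,
      ‖wvar V c α (y + s • α) / wsum V c (y + s • α) ^ 2 - b‖ ≤ K * d * b := by
    intro s hs
    refine ratio_diff V c ha hpos α _ x₀ d hx ?_
    have h1 : s ^ 2 ≤ t ^ 2 := sq_le_sq.2 (abs_le.2 hs)
    refine (sq_le_sq₀ (norm_nonneg _) (norm_nonneg _)).1 ?_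
    rw [hnorm, hnorm]
    gcongr
  have hmv := (convex_Icc (-|t|) |t|).norm_image_sub_le_of_norm_hasDerivWithin_le
    (fun s _ => (hderiv s).hasDerivWithinAt) hbound
    (show (0 : ℝ) ∈ Set.Icc (-|t|) |t| by simp)
    (show t ∈ Set.Icc (-|t|) |t| from ⟨neg_abs_le t, le_abs_self t⟩)
  simp only [zero_smul, add_zero, hS0 y hy, zero_div, zero_mul, sub_zero, Real.norm_eq_abs] at hmv
  refine hmv.trans ?_
  rw [abs_mul, abs_of_nonneg hb0]
  have : 0 ≤ |t| * b * d := by positivity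
  nlinarith
end

section
/- Let α ∈ 𝔞, α ≠ 0, let α̌ = 2α/⟨α,α⟩, and let r_α(x) = x − ⟨α̌, x⟩ α be the orthogonal reflection fixing the hyperplane α^⊥. Assume κ(r_α x) = κ(x) for all x ∈ 𝔞. Then for every δ ∈ M: ⟨s(δ), α̌⟩ · ⟨α, δ⟩ ≥ 0. -/
open scoped RealInnerProductSpace
open Finset

/-- Let `α ≠ 0`, `α̌ = 2α/⟪α,α⟫`, and `r_α x = x - ⟪α̌, x⟫ α` the
orthogonal reflection fixing `α^⊥`.  Assume `κ ∘ r_α = κ`.  Then for every `δ ∈ M`: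
`⟪s δ, α̌⟫ * ⟪α, δ⟫ ≥ 0`, where `s δ` is the unique point with `∇ log κ (s δ) = δ`. -/
theorem statement17 {E : Type*} [NormedAddCommGroup E] [InnerProductSpace ℝ E]
    [FiniteDimensional ℝ E]
    (V : Finset E) (hspan : Submodule.span ℝ (V : Set E) = ⊤)
    (c : E → ℝ) (hc : ∀ v ∈ V, 0 < c v) (hcsum : ∑ v ∈ V, c v = 1)
    (κ : E → ℝ) (hκ : ∀ x, κ x = ∑ v ∈ V, c v * Real.exp ⟪x, v⟫)
    (M : Set E) (hM : M = interior (convexHull ℝ (V : Set E)))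
    (s : E → E) (hs : ∀ δ ∈ M, gradient (fun x => Real.log (κ x)) (s δ) = δ)
    (α : E) (hα : α ≠ 0)
    (hrefl : ∀ x : E, κ (x - ⟪(2 / ⟪α, α⟫) • α, x⟫ • α) = κ x) :
    ∀ δ ∈ M, 0 ≤ ⟪s δ, (2 / ⟪α, α⟫) • α⟫ * ⟪α, δ⟫ := by
  intro δ hδ
  set x := s δ with hx
  set t : ℝ := ⟪(2 / ⟪α, α⟫) • α, x⟫ with ht
  have hne : V.Nonempty := by
    by_contra h
    rw [Finset.not_nonempty_iff_eq_empty] at h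
    simp [h] at hcsum
  have hpos : 0 < κ x := by
    rw [hκ]
    exact Finset.sum_pos (fun v hv => mul_pos (hc v hv) (Real.exp_pos _)) hne
  have hder : HasFDerivAt κ
      (∑ v ∈ V, c v • (Real.exp ⟪x, v⟫ • (innerSL ℝ v))) x := by
    have hk : κ = fun y => ∑ v ∈ V, c v * Real.exp ⟪y, v⟫ := funext hκ
    rw [hk]
    refine HasFDerivAt.fun_sum fun v _ => ?_
    have h1 : HasFDerivAt (fun y : E => ⟪y, v⟫) (innerSL ℝ v) x := by
      have h2 := (innerSL ℝ v).hasFDerivAt (x := x)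
      refine h2.congr_of_eventuallyEq (Filter.Eventually.of_forall fun y => ?_)
      simp [real_inner_comm]
    exact h1.exp.const_mul (c v)
  have hlog := hder.log hpos.ne'
  have hgrad := hs δ hδ
  have hin : ⟪α, δ⟫ = (κ x)⁻¹ * ∑ v ∈ V, c v * (Real.exp ⟪x, v⟫ * ⟪v, α⟫) := by
    rw [← hgrad, real_inner_comm, gradient, InnerProductSpace.toDual_symm_apply, ← hx, hlog.fderiv]
    simp
  have hconv : κ x - t * ∑ v ∈ V, c v * (Real.exp ⟪x, v⟫ * ⟪v, α⟫) ≤ κ x := by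
    conv_rhs => rw [← hrefl x, ← ht]
    rw [hκ, hκ, Finset.mul_sum, ← Finset.sum_sub_distrib]
    refine Finset.sum_le_sum fun v hv => ?_
    have e : ⟪x - t • α, v⟫ = ⟪x, v⟫ + (-(t * ⟪v, α⟫)) := by
      rw [inner_sub_left, real_inner_smul_left, real_inner_comm v α]; ring
    rw [e, Real.exp_add]
    have h1 := Real.add_one_le_exp (-(t * ⟪v, α⟫))
    have h2 := mul_le_mul_of_nonneg_left h1
      (mul_pos (hc v hv) (Real.exp_pos ⟪x, v⟫)).le
    linarith
  rw [real_inner_comm, ← ht, hin]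
  have : 0 ≤ t * ∑ v ∈ V, c v * (Real.exp ⟪x, v⟫ * ⟪v, α⟫) := by linarith
  calc (0:ℝ) ≤ (κ x)⁻¹ * (t * ∑ v ∈ V, c v * (Real.exp ⟪x, v⟫ * ⟪v, α⟫)) :=
        mul_nonneg (inv_pos.mpr hpos).le this
    _ = _ := by ring
end

section
/- Suppose γ ∈ ℕ^r is admissible, and let {X_j}_{j=1}^r be any partial partition of X corresponding to γ (i.e. the X_j are pairwise disjoint, X_j ⊆ C_j, and |X_j| = γ(j)). Let J_γ = { j ∈ {1,…,r} : γ + e_j is not admissible }, where e_j is the j-th standard multi-index. Then ⋃_{j ∈ J_γ} X_j = ⋃_{j ∈ J_γ} C_j. -/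
/-- A multi-index `γ ∈ ℕ^r` is *admissible* (with respect to the sets `C 1, …, C r`) if
there is a partial partition `{X j}` of pairwise disjoint sets with `X j ⊆ C j` and
`|X j| = γ j` for every `j`. -/
def Admissible {α : Type*} {r : ℕ} (C : Fin r → Finset α) (γ : Fin r → ℕ) : Prop :=
  ∃ Xs : Fin r → Finset α,
    (∀ i j, i ≠ j → Disjoint (Xs i) (Xs j)) ∧ ∀ j, Xs j ⊆ C j ∧ (Xs j).card = γ j

/-- Hall: deficiency version for multi-indices. -/
theorem admissible_of_hall {α : Type*} [DecidableEq α] {r : ℕ} (C : Fin r → Finset α)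
    (δ : Fin r → ℕ) (h : ∀ S : Finset (Fin r), ∑ j ∈ S, δ j ≤ (S.biUnion C).card) :
    Admissible C δ := by
  classical
  have key := (Finset.all_card_le_biUnion_card_iff_exists_injective
    (fun p : (Σ j : Fin r, Fin (δ j)) => C p.1)).1 (by
      intro A
      have h1 : A ⊆ (A.image Sigma.fst).sigma (fun j => (Finset.univ : Finset (Fin (δ j)))) := by
        intro p hp
        simp only [Finset.mem_sigma, Finset.mem_univ, and_true]
        exact Finset.mem_image_of_mem _ hp
      have h2 := Finset.card_le_card h1
      rw [Finset.card_sigma] at h2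
      simp only [Finset.card_univ, Fintype.card_fin] at h2
      have h3 := h (A.image Sigma.fst)
      rw [Finset.image_biUnion] at h3
      exact h2.trans h3)
  obtain ⟨f, hf, hfC⟩ := key
  refine ⟨fun j => Finset.univ.image (fun k : Fin (δ j) => f ⟨j, k⟩), ?_, ?_⟩
  · intro i j hij
    rw [Finset.disjoint_left]
    intro a ha hb
    simp only [Finset.mem_image, Finset.mem_univ, true_and] at ha hb
    obtain ⟨k, rfl⟩ := ha
    obtain ⟨l, hl⟩ := hb
    have := congrArg Sigma.fst (hf hl)
    exact hij this.symm
  · intro j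
    constructor
    · intro a ha
      simp only [Finset.mem_image, Finset.mem_univ, true_and] at ha
      obtain ⟨k, rfl⟩ := ha
      exact hfC ⟨j, k⟩
    · rw [Finset.card_image_of_injective]
      · simp
      · intro k l hkl
        exact eq_of_heq (Sigma.mk.inj (hf hkl)).2

theorem hall_of_admissible {α : Type*} [DecidableEq α] {r : ℕ} (C : Fin r → Finset α)
    (δ : Fin r → ℕ) (h : Admissible C δ) (S : Finset (Fin r)) :
    ∑ j ∈ S, δ j ≤ (S.biUnion C).card := by
  obtain ⟨Y, hd, hY⟩ := h
  rw [← Finset.sum_congr rfl (fun j _ => (hY j).2),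
    ← Finset.card_biUnion (fun i _ j _ hij => hd i j hij)]
  exact Finset.card_le_card (Finset.biUnion_mono fun j _ => (hY j).1)

/-- Let `X` be a finite set, `C 1, …, C r ⊆ X`, and let `γ ∈ ℕ^r` be
admissible.  For any partial partition `{X j}` corresponding to `γ`, one has
`⋃_{j ∈ J_γ} X j = ⋃_{j ∈ J_γ} C j`, where
`J_γ = {j : γ + e j is not admissible}`. -/
theorem statement18 {α : Type*} [DecidableEq α] {r : ℕ}
    (X : Finset α) (C : Fin r → Finset α) (hC : ∀ j, C j ⊆ X)
    (γ : Fin r → ℕ) (hγ : Admissible C γ)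
    (Xs : Fin r → Finset α)
    (hdisj : ∀ i j, i ≠ j → Disjoint (Xs i) (Xs j))
    (hsub : ∀ j, Xs j ⊆ C j) (hcard : ∀ j, (Xs j).card = γ j) :
    (⋃ j ∈ {j : Fin r | ¬ Admissible C (γ + Pi.single j 1)}, (Xs j : Set α))
      = ⋃ j ∈ {j : Fin r | ¬ Admissible C (γ + Pi.single j 1)}, (C j : Set α) := by
  apply Set.Subset.antisymm
  · exact Set.iUnion₂_mono fun j _ => Finset.coe_subset.2 (hsub j)
  · intro x hx
    simp only [Set.mem_iUnion, Set.mem_setOf_eq, Finset.mem_coe, exists_prop] at hx ⊢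
    obtain ⟨j, hj, hxj⟩ := hx
    have h1 : ¬ ∀ S : Finset (Fin r),
        ∑ i ∈ S, (γ + Pi.single j 1 : Fin r → ℕ) i ≤ (S.biUnion C).card :=
      fun h => hj (admissible_of_hall C _ h)
    push Not at h1
    obtain ⟨S, hS⟩ := h1
    have hsum : ∀ i, ∑ k ∈ S, (γ + Pi.single i 1 : Fin r → ℕ) k
        = ∑ k ∈ S, γ k + if i ∈ S then 1 else 0 := by
      intro i
      simp [Finset.sum_add_distrib, Finset.sum_pi_single]
    have hXc : (S.biUnion Xs).card = ∑ k ∈ S, γ k := by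
      rw [Finset.card_biUnion (fun i _ j _ hij => hdisj i j hij)]
      exact Finset.sum_congr rfl fun k _ => hcard k
    have hXC : S.biUnion Xs ⊆ S.biUnion C := Finset.biUnion_mono fun k _ => hsub k
    have hle := Finset.card_le_card hXC
    rw [hsum] at hS
    have hjS : j ∈ S := by
      by_contra hn
      rw [if_neg hn] at hS
      omega
    rw [if_pos hjS] at hS
    have heq : S.biUnion Xs = S.biUnion C := Finset.eq_of_subset_of_card_le hXC (by omega)
    have hxS : x ∈ S.biUnion Xs := heq ▸ Finset.mem_biUnion.2 ⟨j, hjS, hxj⟩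
    obtain ⟨i, hiS, hxi⟩ := Finset.mem_biUnion.1 hxS
    refine ⟨i, fun hi => ?_, hxi⟩
    have := hall_of_admissible C _ hi S
    rw [hsum, if_pos hiS] at this
    omega
end
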